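/- Let k ≥ 1 and n be natural numbers and let φ : F_n →* N_k be a surjective homomorphism onto the nonorientable genus-k surface group. Then either φ is reducible (there is an automorphism α of F_n and an index i with (φ ∘ α)(x_i) = 1), or n = k and there is an automorphism α of F_k with φ ∘ α equal to the standard epimorphism ρ_k. -/

import Mathlib

/-- The single relator `x_0² x_1² ⋯ x_{k-1}²` of the nonorientable genus-`k`
surface group, as an element of the free group on `Fin k`. -/
def nonorientableRelator (k : ℕ) : FreeGroup (Fin k) :=
  ((List.finRange k).map (fun i => (FreeGroup.of i) ^ 2)).prod

/-- The nonorientable genus-`k` surface group. -/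
def NonorientableSurfaceGroup (k : ℕ) : Type :=
  PresentedGroup ({nonorientableRelator k} : Set (FreeGroup (Fin k)))

instance (k : ℕ) : Group (NonorientableSurfaceGroup k) :=
  inferInstanceAs (Group (PresentedGroup _))

/-- The standard epimorphism `ρ_k : F_k →* N_k`, the quotient map of the presentation. -/
def standardRho (k : ℕ) : FreeGroup (Fin k) →* NonorientableSurfaceGroup k :=
  PresentedGroup.mk _


namespace NSG

/-- Words read along paths in a graph whose steps carry labels in a group. -/
inductive GPath {V G : Type} [Group G] (St : V → G → V → Prop) : V → G → V → Prop
  | nil (v : V) : GPath St v 1 v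
  | fwd {v w u : V} {g h : G} : St v g w → GPath St w h u → GPath St v (g * h) u
  | bwd {v w u : V} {g h : G} : St w g v → GPath St w h u → GPath St v (g⁻¹ * h) u

namespace GPath

variable {V V' G G' : Type} [Group G] [Group G'] {St : V → G → V → Prop} {St' : V' → G' → V' → Prop}

theorem trans {v w u : V} {g h : G} (p : GPath St v g w) (q : GPath St w h u) :
    GPath St v (g * h) u := by
  induction p with
  | nil v => simpa using q
  | fwd s _ ih => rw [mul_assoc]; exact fwd s (ih q)
  | bwd s _ ih => rw [mul_assoc]; exact bwd s (ih q)

theorem single {v w : V} {g : G} (s : St v g w) : GPath St v g w := by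
  simpa using fwd s (nil w)

theorem single_inv {v w : V} {g : G} (s : St v g w) : GPath St w g⁻¹ v := by
  simpa using bwd s (nil v)

theorem symm {v w : V} {g : G} (p : GPath St v g w) : GPath St w g⁻¹ v := by
  induction p with
  | nil v => simpa using nil (St := St) v
  | fwd s _ ih => rw [mul_inv_rev]; exact ih.trans (single_inv s)
  | bwd s _ ih => rw [mul_inv_rev, inv_inv]; exact ih.trans (single s)

theorem map (f : V → V') (θ : G →* G')
    (hst : ∀ v g w, St v g w → GPath St' (f v) (θ g) (f w)) {v w : V} {g : G}
    (p : GPath St v g w) : GPath St' (f v) (θ g) (f w) := by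
  induction p with
  | nil v => simpa using nil (St := St') (f v)
  | fwd s _ ih => rw [map_mul]; exact (hst _ _ _ s).trans ih
  | bwd s _ ih => rw [map_mul, map_inv]; exact (hst _ _ _ s).symm.trans ih

theorem mono {St₂ : V → G → V → Prop} (hst : ∀ v g w, St v g w → GPath St₂ v g w)
    {v w : V} {g : G} (p : GPath St v g w) : GPath St₂ v g w :=
  map id (MonoidHom.id G) hst p

end GPath

/-- The steps of a labelled graph. -/
def EdSt {V : Type} {k : ℕ} (Ed : V → Fin k → V → Prop) (v : V) (g : FreeGroup (Fin k)) (w : V) :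
    Prop := ∃ i, g = FreeGroup.of i ∧ Ed v i w

/-- The steps of a labelled graph with the labels doubled by a function on edges. -/
def RSt {V : Type} {k : ℕ} {G : Type} (Ed : V → Fin k → V → Prop) (κ : V → Fin k → G)
    (v : V) (g : FreeGroup (Fin k) × G) (w : V) :
    Prop := ∃ i, g = (FreeGroup.of i, κ v i) ∧ Ed v i w

/-- Deterministic (folded) labelled graphs. -/
def Det {V : Type} {k : ℕ} (Ed : V → Fin k → V → Prop) : Prop :=
  (∀ v i w w', Ed v i w → Ed v i w' → w = w') ∧ (∀ v v' i w, Ed v i w → Ed v' i w → v = v')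

section det
variable {V : Type} {k : ℕ} {G : Type} [Group G] {Ed : V → Fin k → V → Prop}

open Classical in
/-- One half of the doubling permutation. -/
noncomputable def dbl {V : Type} (R : V → V → Prop) : V ⊕ V → V ⊕ V
  | Sum.inl w => if h : ∃ v, R v w then Sum.inl h.choose else Sum.inr w
  | Sum.inr v => if h : ∃ w, R v w then Sum.inr h.choose else Sum.inl v

theorem dbl_inl {R : V → V → Prop} (h2 : ∀ v v' w, R v w → R v' w → v = v') {v w : V}
    (h : R v w) : dbl R (Sum.inl w) = Sum.inl v := by
  have h' : ∃ v, R v w := ⟨v, h⟩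
  simp only [dbl, dif_pos h']
  exact congrArg _ (h2 _ _ _ h'.choose_spec h)

theorem dbl_inr {R : V → V → Prop} (h1 : ∀ v w w', R v w → R v w' → w = w') {v w : V}
    (h : R v w) : dbl R (Sum.inr v) = Sum.inr w := by
  have h' : ∃ w, R v w := ⟨w, h⟩
  simp only [dbl, dif_pos h']
  exact congrArg _ (h1 _ _ _ h'.choose_spec h)

theorem dbl_inv (R : V → V → Prop) (h1 : ∀ v w w', R v w → R v w' → w = w')
    (h2 : ∀ v v' w, R v w → R v' w → v = v') (x : V ⊕ V) :
    dbl (fun w v => R v w) (dbl R x) = x := by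
  rcases x with w | v
  · by_cases h : ∃ v, R v w
    · obtain ⟨v, hv⟩ := h
      rw [dbl_inl h2 hv, dbl_inl (R := fun w v => R v w) (fun a b c h h' => h1 c a b h h') hv]
    · have : dbl R (Sum.inl w) = Sum.inr w := by simp only [dbl, dif_neg h]
      rw [this]; simp only [dbl, dif_neg h]
  · by_cases h : ∃ w, R v w
    · obtain ⟨w, hw⟩ := h
      rw [dbl_inr h1 hw, dbl_inr (R := fun w v => R v w) (fun a b c h h' => h2 b c a h h') hw]
    · have : dbl R (Sum.inr v) = Sum.inl v := by simp only [dbl, dif_neg h]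
      rw [this]; simp only [dbl, dif_neg h]

/-- The doubling permutation extending a partial injection. -/
noncomputable def dblEquiv (R : V → V → Prop) (h1 : ∀ v w w', R v w → R v w' → w = w')
    (h2 : ∀ v v' w, R v w → R v' w → v = v') : Equiv.Perm (V ⊕ V) where
  toFun := dbl R
  invFun := dbl (fun w v => R v w)
  left_inv := dbl_inv R h1 h2
  right_inv := dbl_inv (fun w v => R v w) (fun a b c h h' => h2 b c a h h')
    (fun a b c h h' => h1 c a b h h')

open Classical in
/-- The action of the free group on a doubled graph. -/
noncomputable def act (hd : Det Ed) (κ : V → Fin k → G) :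
    FreeGroup (Fin k) →* Equiv.Perm ((V ⊕ V) × G) :=
  FreeGroup.lift fun i => Equiv.prodShear
    (dblEquiv (fun v w => Ed v i w) (fun v w w' => hd.1 v i w w') (fun v v' w => hd.2 v v' i w))
    (fun x => Equiv.mulLeft (Sum.elim (fun w => if h : ∃ v, Ed v i w then κ h.choose i else 1)
      (fun _ => 1) x))

theorem act_edge (hd : Det Ed) (κ : V → Fin k → G) {v w : V} {i : Fin k} (h : Ed v i w) (t : G) :
    act hd κ (FreeGroup.of i) (Sum.inl w, t) = (Sum.inl v, κ v i * t) := by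
  have h' : ∃ v, Ed v i w := ⟨v, h⟩
  have e : h'.choose = v := hd.2 _ _ _ _ h'.choose_spec h
  simp only [act, FreeGroup.lift_apply_of, Equiv.prodShear_apply, Equiv.coe_mulLeft, Sum.elim_inl,
    dif_pos h', e]
  refine Prod.ext ?_ rfl
  exact dbl_inl (R := fun v w => Ed v i w) (fun v v' w => hd.2 v v' i w) h

theorem act_path (hd : Det Ed) (κ : V → Fin k → G) {v w : V} {g : FreeGroup (Fin k) × G}
    (p : GPath (RSt Ed κ) v g w) (t : G) :
    act hd κ g.1 (Sum.inl w, t) = (Sum.inl v, g.2 * t) := by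
  induction p with
  | nil v => simp
  | fwd s _ ih =>
    obtain ⟨i, rfl, he⟩ := s
    simp only [Prod.fst_mul, Prod.snd_mul, map_mul, Equiv.Perm.mul_apply, ih, mul_assoc]
    exact act_edge hd κ he _
  | bwd s _ ih =>
    obtain ⟨i, rfl, he⟩ := s
    simp only [Prod.fst_mul, Prod.snd_mul, map_mul, Equiv.Perm.mul_apply, ih, mul_assoc,
      Prod.fst_inv, Prod.snd_inv, map_inv]
    rw [Equiv.Perm.inv_eq_iff_eq, act_edge hd κ he]
    simp

theorem rpath_unique (hd : Det Ed) (κ : V → Fin k → G) {v w : V} {g : FreeGroup (Fin k)} {h h' : G}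
    (p : GPath (RSt Ed κ) v (g, h) w) (p' : GPath (RSt Ed κ) v (g, h') w) : h = h' := by
  have a := act_path hd κ p 1
  have b := act_path hd κ p' 1
  simp only at a b
  rw [a] at b
  simpa using b

theorem path_to_rpath (κ : V → Fin k → G) {v w : V} {g : FreeGroup (Fin k)}
    (p : GPath (EdSt Ed) v g w) : ∃ h, GPath (RSt Ed κ) v (g, h) w := by
  induction p with
  | nil v => exact ⟨1, GPath.nil v⟩
  | @fwd v w u _ _ s _ ih =>
    obtain ⟨i, rfl, he⟩ := s
    obtain ⟨h, ih⟩ := ih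
    exact ⟨κ v i * h, GPath.fwd (g := (FreeGroup.of i, κ v i)) ⟨i, rfl, he⟩ ih⟩
  | @bwd v w u _ _ s _ ih =>
    obtain ⟨i, rfl, he⟩ := s
    obtain ⟨h, ih⟩ := ih
    exact ⟨(κ w i)⁻¹ * h, GPath.bwd (g := (FreeGroup.of i, κ w i)) ⟨i, rfl, he⟩ ih⟩

theorem rpath_to_path (κ : V → Fin k → G) {v w : V} {g : FreeGroup (Fin k) × G}
    (p : GPath (RSt Ed κ) v g w) : GPath (EdSt Ed) v g.1 w :=
  GPath.map id (MonoidHom.fst _ _) (by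
    rintro v g w ⟨i, rfl, he⟩
    exact GPath.single ⟨i, rfl, he⟩) p

theorem det_letter (hd : Det Ed) {v w : V} {i : Fin k}
    (p : GPath (EdSt Ed) v (FreeGroup.of i) w) : Ed v i w := by
  obtain ⟨h, q⟩ := path_to_rpath (fun _ _ => (1 : Multiplicative ℤ)) p
  have := act_path hd _ q 1
  simp only [act, FreeGroup.lift_apply_of, Equiv.prodShear_apply] at this
  have h1 := congrArg Prod.fst this
  simp only [dblEquiv, Equiv.coe_fn_mk, dbl] at h1
  split_ifs at h1 with h2
  have := h2.choose_spec
  rw [Sum.inl.inj h1] at this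
  exact this

end det
end NSG

namespace NSG

section cyc
variable {G G' : Type} [Group G] [Group G'] {N : ℕ}

/-- Product of cyclically indexed elements, starting at `q`, of length `t`. -/
def cyc (x : ZMod N → G) : ZMod N → ℕ → G
  | _, 0 => 1
  | q, t + 1 => x q * cyc x (q + 1) t

theorem cyc_add (x : ZMod N → G) (q : ZMod N) (s t : ℕ) :
    cyc x q (s + t) = cyc x q s * cyc x (q + s) t := by
  induction s generalizing q with
  | zero => simp [cyc]
  | succ s ih =>
    have : s + 1 + t = (s + t) + 1 := by omega
    rw [this, cyc, cyc, ih, mul_assoc]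
    congr 3
    push_cast; ring

theorem cyc_one (x : ZMod N → G) (q : ZMod N) : cyc x q 1 = x q := by simp [cyc]

theorem cyc_rot (x : ZMod N → G) (q : ZMod N) : x q * cyc x (q + 1) N = cyc x q N * x q := by
  have h1 := cyc_add x q 1 N
  have h2 := cyc_add x q N 1
  rw [add_comm, h1] at h2
  simpa [cyc_one] using h2

theorem cyc_congr {x x' : ZMod N → G} {q : ZMod N} {t : ℕ}
    (h : ∀ i : ℕ, i < t → x (q + i) = x' (q + i)) : cyc x q t = cyc x' q t := by
  induction t generalizing q with
  | zero => rfl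
  | succ t ih =>
    rw [cyc, cyc]
    congr 1
    · simpa using h 0 (by omega)
    · apply ih
      intro i hi
      have := h (i + 1) (by omega)
      push_cast at this
      rw [add_assoc, add_comm (1 : ZMod N) (i : ZMod N)]
      exact this

theorem map_cyc (f : G →* G') (x : ZMod N → G) (q : ZMod N) (t : ℕ) :
    f (cyc x q t) = cyc (fun i => f (x i)) q t := by
  induction t generalizing q with
  | zero => simp [cyc]
  | succ t ih => rw [cyc, cyc, map_mul, ih]

theorem cyc_path {V : Type} {St : V → G → V → Prop} (c : ZMod N → V) (x : ZMod N → G)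
    (q : ZMod N) (t : ℕ)
    (h : ∀ i : ℕ, i < t → GPath St (c (q + i)) (x (q + i)) (c (q + i + 1))) :
    GPath St (c q) (cyc x q t) (c (q + t)) := by
  induction t generalizing q with
  | zero => simpa [cyc] using GPath.nil (St := St) (c q)
  | succ t ih =>
    rw [cyc]
    refine GPath.trans (w := c (q + 1)) (by simpa using h 0 (by omega)) ?_
    have := ih (q + 1) (fun i hi => by
      have := h (i + 1) (by omega)
      push_cast at this
      rw [add_assoc, add_comm (1 : ZMod N) (i : ZMod N)]
      exact this)
    have e : q + ((t + 1 : ℕ) : ZMod N) = q + 1 + t := by push_cast; ring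
    rw [e]; exact this

/-- every position is reached -/
theorem exists_shift [NeZero N] (p q : ZMod N) : ∃ t < N, q = p + (t : ℕ) :=
  ⟨(q - p).val, ZMod.val_lt _, by simp⟩

theorem shift_ne [NeZero N] (p : ZMod N) (t : ℕ) (h1 : 0 < t) (h2 : t < N) : p + (t : ZMod N) ≠ p := by
  intro h
  have h3 : (t : ZMod N) = 0 := by simpa using h
  rw [ZMod.natCast_eq_zero_iff] at h3
  exact absurd (Nat.le_of_dvd h1 h3) (by omega)

end cyc

section labels
variable {k : ℕ} [NeZero k]

/-- The label of a position on the relator. -/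
def lab (q : ZMod (2 * k)) : Fin k := ⟨q.val / 2, by
  have := ZMod.val_lt q; omega⟩

/-- Even positions. -/
def Evn (q : ZMod (2 * k)) : Prop := q.val % 2 = 0

theorem val_succ (q : ZMod (2 * k)) :
    ((q + 1).val = q.val + 1 ∧ q.val + 1 < 2 * k) ∨ ((q + 1).val = 0 ∧ q.val + 1 = 2 * k) := by
  have hq := ZMod.val_lt q
  have h0 : k ≠ 0 := NeZero.ne k
  have e : (q + 1).val = (q.val + 1) % (2 * k) := by
    rw [ZMod.val_add]
    have : (1 : ZMod (2 * k)).val = 1 := ZMod.val_one'' (by omega)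
    rw [this]
  by_cases h : q.val + 1 = 2 * k
  · right; rw [e, h]; simp
  · left; rw [e, Nat.mod_eq_of_lt (by omega)]; omega

theorem evn_succ (q : ZMod (2 * k)) : Evn (q + 1) ↔ ¬ Evn q := by
  unfold Evn
  rcases val_succ q with h | h <;> omega

theorem evn_pred (q : ZMod (2 * k)) : Evn (q - 1) ↔ ¬ Evn q := by
  have := evn_succ (q - 1)
  rw [sub_add_cancel] at this
  tauto

open Classical in
/-- The other position with the same label. -/
noncomputable def dual (q : ZMod (2 * k)) : ZMod (2 * k) := if Evn q then q + 1 else q - 1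

theorem dual_evn {q : ZMod (2 * k)} (h : Evn q) : dual q = q + 1 := if_pos h
theorem dual_odd {q : ZMod (2 * k)} (h : ¬ Evn q) : dual q = q - 1 := if_neg h

theorem lab_succ {q : ZMod (2 * k)} (h : Evn q) : lab (q + 1) = lab q := by
  have : (q + 1).val / 2 = q.val / 2 := by
    unfold Evn at h
    rcases val_succ q with h' | h' <;> omega
  exact Fin.ext this

theorem lab_dual (q : ZMod (2 * k)) : lab (dual q) = lab q := by
  by_cases h : Evn q
  · rw [dual_evn h, lab_succ h]
  · rw [dual_odd h]
    have := lab_succ ((evn_pred q).2 h)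
    rw [sub_add_cancel] at this
    exact this.symm

theorem dual_ne (q : ZMod (2 * k)) : dual q ≠ q := by
  intro h'
  by_cases h : Evn q
  · rw [dual_evn h] at h'
    have := (evn_succ q).not.2 (not_not.2 h)
    rw [h'] at this; exact this h
  · rw [dual_odd h] at h'
    have := (evn_pred q).2 h
    rw [h'] at this; exact h this

theorem lab_eq {p q : ZMod (2 * k)} (h : lab q = lab p) : q = p ∨ q = dual p := by
  have h1 : q.val / 2 = p.val / 2 := congrArg Fin.val h
  by_cases h3 : q.val = p.val
  · left; exact ZMod.val_injective _ h3
  · right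
    apply ZMod.val_injective
    by_cases h2 : Evn p
    · rw [dual_evn h2]
      unfold Evn at h2
      have hq := ZMod.val_lt q
      rcases val_succ p with h' | h' <;> omega
    · rw [dual_odd h2]
      unfold Evn at h2
      have := val_succ (p - 1)
      rw [sub_add_cancel] at this
      omega

theorem succ_ne (p : ZMod (2 * k)) : p + 1 ≠ p := by
  intro h
  have := evn_succ p
  rw [h] at this
  tauto

/-- The cyclic relator word. -/
def W (q : ZMod (2 * k)) (t : ℕ) : FreeGroup (Fin k) := cyc (fun i => FreeGroup.of (lab i)) q t

theorem W_add (q : ZMod (2 * k)) (s t : ℕ) : W q (s + t) = W q s * W (q + (s : ZMod (2 * k))) t :=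
  cyc_add _ _ _ _

theorem W_one (q : ZMod (2 * k)) : W q 1 = FreeGroup.of (lab q) :=
  cyc_one (fun i => FreeGroup.of (lab i)) q

theorem W_rot (q : ZMod (2 * k)) : FreeGroup.of (lab q) * W (q + 1) (2 * k) =
    W q (2 * k) * FreeGroup.of (lab q) :=
  cyc_rot (fun i => FreeGroup.of (lab i)) q

theorem W_zero_eq : W (0 : ZMod (2 * k)) (2 * k) = nonorientableRelator k := by
  have key : ∀ t, t ≤ k → W (0 : ZMod (2 * k)) (2 * t) =
      (((List.finRange k).map (fun i => (FreeGroup.of i) ^ 2)).take t).prod := by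
    intro t
    induction t with
    | zero => intro; simp [W, cyc]
    | succ t ih =>
      intro ht
      have e : 2 * (t + 1) = 2 * t + 2 := by ring
      rw [e, W_add, ih (by omega), List.prod_take_succ _ _ (by simp; omega)]
      congr 1
      have e1 : lab ((0 : ZMod (2 * k)) + ((2 * t : ℕ) : ZMod (2 * k))) = ⟨t, by omega⟩ := by
        apply Fin.ext
        simp only [lab, zero_add]
        rw [ZMod.val_natCast, Nat.mod_eq_of_lt (by omega)]
        exact Nat.mul_div_cancel_left t (by norm_num)
      have e2 : lab ((0 : ZMod (2 * k)) + ((2 * t : ℕ) : ZMod (2 * k)) + 1) = ⟨t, by omega⟩ := by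
        rw [lab_succ, e1]
        simp only [Evn, zero_add]
        rw [ZMod.val_natCast, Nat.mod_eq_of_lt (show 2 * t < 2 * k by omega)]; omega
      simp only [W, cyc, e1, e2, mul_one]
      simp [pow_two]
  have := key k le_rfl
  rw [this, List.take_of_length_le (by simp)]
  rfl

theorem rho_W {Q : Type} [Group Q] (ρ : FreeGroup (Fin k) →* Q)
    (h : ρ (nonorientableRelator k) = 1) (q : ZMod (2 * k)) : ρ (W q (2 * k)) = 1 := by
  obtain ⟨t, -, rfl⟩ := exists_shift 0 q
  induction t with
  | zero => simpa [W_zero_eq] using h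
  | succ t ih =>
    have := congrArg ρ (W_rot (0 + (t : ZMod (2 * k))))
    rw [map_mul, map_mul, ih, one_mul] at this
    have e : (0 : ZMod (2 * k)) + ((t + 1 : ℕ) : ZMod (2 * k)) = 0 + (t : ZMod (2 * k)) + 1 := by
      push_cast; ring
    rw [e]
    simpa using this

end labels
end NSG

namespace NSG

section fold
variable {V : Type} {k : ℕ}

theorem det_end {Ed : V → Fin k → V → Prop} (hd : Det Ed) {v w w' : V} {g : FreeGroup (Fin k)}
    (p : GPath (EdSt Ed) v g w) (p' : GPath (EdSt Ed) v g w') : w = w' := by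
  obtain ⟨h, q⟩ := path_to_rpath (fun _ _ => (1 : Multiplicative (ZMod 1))) p
  obtain ⟨h', q'⟩ := path_to_rpath (fun _ _ => (1 : Multiplicative (ZMod 1))) p'
  have a := act_path hd _ q 1
  have a' := act_path hd _ q' 1
  have e : h = h' := Subsingleton.elim (α := ZMod 1) _ _
  subst e
  rw [← a'] at a
  have := (Equiv.injective _) a
  exact Sum.inl.inj (congrArg Prod.fst this)

/-- Vertices joined by a path with trivial label are identified. -/
def foldSetoid (St : V → FreeGroup (Fin k) → V → Prop) : Setoid V where
  r v w := GPath St v 1 w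
  iseqv := ⟨fun v => GPath.nil v, fun p => by simpa using p.symm,
    fun p q => by simpa using p.trans q⟩

/-- The folded vertex set. -/
abbrev FoldV (St : V → FreeGroup (Fin k) → V → Prop) : Type := Quotient (foldSetoid St)

/-- The projection to the folded vertex set. -/
def fmk (St : V → FreeGroup (Fin k) → V → Prop) (v : V) : FoldV St := Quotient.mk (foldSetoid St) v

/-- The edges of the folded graph. -/
def FoldEd (St : V → FreeGroup (Fin k) → V → Prop) (z : FoldV St) (i : Fin k) (z' : FoldV St) : Prop :=
  ∃ v w, fmk St v = z ∧ fmk St w = z' ∧ St v (FreeGroup.of i) w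

variable {St : V → FreeGroup (Fin k) → V → Prop}

theorem fmk_eq {v w : V} : fmk St v = fmk St w ↔ GPath St v 1 w := Quotient.eq (r := foldSetoid St)

theorem fmk_surj (z : FoldV St) : ∃ v, fmk St v = z := Quotient.exists_rep z

theorem fold_det (St : V → FreeGroup (Fin k) → V → Prop) : Det (FoldEd St) := by
  constructor
  · rintro z i w w' ⟨a, b, rfl, rfl, h⟩ ⟨a', b', h1, rfl, h'⟩
    rw [fmk_eq] at h1 ⊢
    have := (GPath.single_inv h).trans (h1.symm.trans (GPath.single h'))
    simpa using this
  · rintro z z' i w ⟨a, b, rfl, rfl, h⟩ ⟨a', b', rfl, h1, h'⟩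
    rw [fmk_eq] at h1 ⊢
    have := (GPath.single h).trans (h1.symm.trans (GPath.single_inv h'))
    simpa using this

theorem fold_path (hSt : ∀ v g w, St v g w → g = 1 ∨ ∃ i, g = FreeGroup.of i) {v w : V}
    {g : FreeGroup (Fin k)} (p : GPath St v g w) :
    GPath (EdSt (FoldEd St)) (fmk St v) g (fmk St w) := by
  refine GPath.map (fmk St) (MonoidHom.id _) ?_ p
  intro v g w h
  rcases hSt v g w h with rfl | ⟨i, rfl⟩
  · have : fmk St v = fmk St w := fmk_eq.2 (GPath.single h)
    rw [this]
    exact GPath.nil _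
  · exact GPath.single ⟨i, rfl, v, w, rfl, rfl, h⟩

theorem fold_path_inv {z z' : FoldV St} {g : FreeGroup (Fin k)}
    (p : GPath (EdSt (FoldEd St)) z g z') : ∀ v w, fmk St v = z → fmk St w = z' →
    GPath St v g w := by
  induction p with
  | nil z =>
    rintro v w rfl h
    exact fmk_eq.1 h.symm
  | fwd s _ ih =>
    rintro v w rfl rfl
    obtain ⟨i, rfl, a, b, h1, rfl, h⟩ := s
    have := (fmk_eq.1 h1).symm.trans ((GPath.single h).trans (ih b w rfl rfl))
    simpa using this
  | bwd s _ ih =>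
    rintro v w rfl rfl
    obtain ⟨i, rfl, a, b, rfl, h1, h⟩ := s
    have := (fmk_eq.1 h1).symm.trans ((GPath.single_inv h).trans (ih a w rfl rfl))
    simpa using this

end fold

section configs
variable {k n : ℕ} [NeZero k] {Q : Type} [Group Q]

/-- Edges of a graph together with one jump. -/
def JSt {V : Type} (Ed : V → Fin k → V → Prop) (a b : V) (v : V) (g : FreeGroup (Fin k)) (w : V) :
    Prop := EdSt Ed v g w ∨ (v = a ∧ g = 1 ∧ w = b)

/-- The conclusion: there is a surjective lift. -/
def Concl (ρ : FreeGroup (Fin k) →* Q) (φ : FreeGroup (Fin n) →* Q) : Prop :=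
  ∃ ψ : FreeGroup (Fin n) →* FreeGroup (Fin k), ρ.comp ψ = φ ∧ Function.Surjective ψ

/-- The main claim with at most `s` additional conjugates of the relator. -/
def MainP (ρ : FreeGroup (Fin k) →* Q) (φ : FreeGroup (Fin n) →* Q) (s : ℕ) : Prop :=
  ∀ (ψ : FreeGroup (Fin n) →* FreeGroup (Fin k)) (S : Finset (FreeGroup (Fin k))),
    ρ.comp ψ = φ → S.card ≤ s →
    (∀ m ∈ S, ∃ (q : ZMod (2 * k)) (τ : FreeGroup (Fin k)), m = τ * W q (2 * k) * τ⁻¹) →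
    (∀ g, g ∈ Subgroup.closure (Set.range ψ ∪ (S : Set (FreeGroup (Fin k))))) → Concl ρ φ

/-- The combinatorial configurations used in the induction. -/
structure Config (ρ : FreeGroup (Fin k) →* Q) (φ : FreeGroup (Fin n) →* Q) (s : ℕ) (V : Type)
    (Ed : V → Fin k → V → Prop) (v0 : V) (ψ : FreeGroup (Fin n) →* FreeGroup (Fin k))
    (S : Finset (FreeGroup (Fin k))) (u : ZMod (2 * k) → V) (j : ZMod (2 * k)) (b : V) : Prop where
  det : Det Ed
  conn : ∀ v, ∃ g, GPath (EdSt Ed) v0 g v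
  lift : ρ.comp ψ = φ
  loop : ∀ x, GPath (EdSt Ed) v0 (ψ x) v0
  card : S.card ≤ s
  cycles : ∀ m ∈ S, ∃ c : ZMod (2 * k) → V, (∀ q, Ed (c q) (lab q) (c (q + 1))) ∧
    ∃ q τ, GPath (EdSt Ed) v0 τ (c q) ∧ m = τ * W q (2 * k) * τ⁻¹
  gen : ∀ g, GPath (EdSt Ed) v0 g v0 →
    g ∈ Subgroup.closure (Set.range ψ ∪ (S : Set (FreeGroup (Fin k))))
  cell1 : ∀ q, q ≠ j - 1 → Ed (u q) (lab q) (u (q + 1))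
  cell2 : Ed (u (j - 1)) (lab (j - 1)) b
  full : ∀ g, GPath (JSt Ed (u j) b) v0 g v0

theorem link {V : Type} {Ed : V → Fin k → V → Prop} (det : Det Ed)
    (C : Set (ZMod (2 * k) → V)) (hC : ∀ c ∈ C, ∀ q, Ed (c q) (lab q) (c (q + 1)))
    (u : ZMod (2 * k) → V) (j : ZMod (2 * k)) (b : V)
    (cell1 : ∀ q, q ≠ j - 1 → Ed (u q) (lab q) (u (q + 1)))
    (cell2 : Ed (u (j - 1)) (lab (j - 1)) b) (hab : u j ≠ b) :
    ∃ v p, ((∃ c ∈ C, c p = v) ∨ u p = v) ∧ ¬ ((∃ c ∈ C, c (dual p) = v) ∨ u (dual p) = v) := by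
  by_contra! hcon
  set Cov : V → ZMod (2 * k) → Prop := fun v p => (∃ c ∈ C, c p = v) ∨ u p = v with hCov
  have H : ∀ v p, Cov v p → Cov v (dual p) := by
    intro v p h
    by_contra h'
    have := hcon v p h
    simp only [hCov] at h'
    push Not at h'
    grind
  set a := u j with ha
  set T : ZMod (2 * k) → Prop := fun q => ∃ v, Cov v (q - 1) ∧ Ed v (lab (q - 1)) a with hT
  have T1 : ∀ q, T q → T (dual (q - 1) + 1) := by
    rintro q ⟨v, h1, h2⟩
    refine ⟨v, ?_, ?_⟩
    · rw [add_sub_cancel_right]; exact H _ _ h1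
    · rw [add_sub_cancel_right, lab_dual]; exact h2
  have Tev : ∀ q, Evn q → T q → T (q - 1) := by
    intro q hq h
    have h1 := T1 q h
    have h2 : ¬ Evn (q - 1) := fun h => (evn_pred q).1 h hq
    rw [dual_odd h2] at h1
    have e : q - 1 - 1 + 1 = q - 1 := by ring
    rwa [e] at h1
  have Tod : ∀ q, ¬ Evn q → T q → T (q + 1) := by
    intro q hq h
    have h1 := T1 q h
    rw [dual_evn ((evn_pred q).2 hq)] at h1
    have e : q - 1 + 1 + 1 = q + 1 := by ring
    rwa [e] at h1
  have TS : ∀ q, T q → Cov a q := by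
    rintro q ⟨v, ⟨c, hc, rfl⟩ | rfl, h2⟩
    · left
      refine ⟨c, hc, ?_⟩
      have := hC c hc (q - 1)
      rw [sub_add_cancel] at this
      exact det.1 _ _ _ _ this h2
    · right
      by_cases hq : q = j
      · subst hq
        rfl
      · have := cell1 (q - 1) (fun h => hq (by simpa using h))
        rw [sub_add_cancel] at this
        exact det.1 _ _ _ _ this h2
  have ST : ∀ q, q ≠ j → Cov a q → T q := by
    rintro q hq (⟨c, hc, h⟩ | h)
    · refine ⟨c (q - 1), Or.inl ⟨c, hc, rfl⟩, ?_⟩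
      have := hC c hc (q - 1)
      rwa [sub_add_cancel, h] at this
    · refine ⟨u (q - 1), Or.inr rfl, ?_⟩
      have := cell1 (q - 1) (fun h => hq (by simpa using h))
      rwa [sub_add_cancel, h] at this
  have Tj : ¬ T j := by
    rintro ⟨v, ⟨c, hc, rfl⟩ | rfl, h2⟩
    · have e0 := hC c hc (j - 1)
      rw [sub_add_cancel] at e0
      have e1 : c j = a := det.1 _ _ _ _ e0 h2
      have e2 : ∀ t : ℕ, t < 2 * k → c (j + t) = u (j + t) := by
        intro t
        induction t with
        | zero => intro; simpa using e1
        | succ t ih =>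
          intro ht
          have i1 := hC c hc (j + t)
          rw [ih (by omega)] at i1
          have i2 := cell1 (j + t) (fun h => by
            have := shift_ne j (t + 1) (by omega) ht
            apply this
            push_cast
            rw [← add_assoc, h]; ring)
          have := det.1 _ _ _ _ i1 i2
          push_cast
          rwa [← add_assoc]
      obtain ⟨t, ht, e3⟩ := exists_shift j (j - 1)
      have e4 := e2 t ht
      rw [← e3] at e4
      rw [e4] at h2
      exact hab (det.1 _ _ _ _ h2 cell2)
    · exact hab (det.1 _ _ _ _ h2 cell2)
  have Sj : Cov a j := Or.inr rfl
  have ne1 : ∀ q, (Evn q ↔ ¬ Evn j) → q ≠ j := by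
    rintro q h rfl
    tauto
  have hk0 : k ≠ 0 := NeZero.ne k
  by_cases hj : Evn j
  · have stepS : ∀ q, Evn q → Cov a q → T (q + 2) := by
      intro q hq hS
      have h1 := H _ _ hS
      rw [dual_evn hq] at h1
      have hq1 : ¬ Evn (q + 1) := fun h => (evn_succ q).1 h hq
      have h2 := Tod _ hq1 (ST _ (ne1 _ (by tauto)) h1)
      have e : q + 1 + 1 = q + 2 := by ring
      rwa [e] at h2
    have evn2 : ∀ q : ZMod (2 * k), Evn q → Evn (q + 2) := by
      intro q hq
      have e : q + 2 = q + 1 + 1 := by ring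
      rw [e, evn_succ, evn_succ]; tauto
    have key : ∀ t : ℕ, T (j + 2 * (t + 1)) ∧ Evn (j + 2 * ((t : ZMod (2 * k)) + 1)) := by
      intro t
      induction t with
      | zero => simpa using ⟨stepS j hj Sj, evn2 j hj⟩
      | succ t ih =>
        have e : j + 2 * (((t + 1 : ℕ) : ZMod (2 * k)) + 1) = j + 2 * ((t : ZMod (2 * k)) + 1) + 2 := by
          push_cast; ring
        rw [e]
        exact ⟨stepS _ ih.2 (TS _ ih.1), evn2 _ ih.2⟩
    have := (key (k - 1)).1
    have e : (2 : ZMod (2 * k)) * (((k - 1 : ℕ) : ZMod (2 * k)) + 1) = 0 := by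
      have h1 : ((2 * k : ℕ) : ZMod (2 * k)) = 0 := ZMod.natCast_self _
      have h2 : ((k - 1 + 1 : ℕ) : ZMod (2 * k)) = (k : ZMod (2 * k)) :=
        congrArg (Nat.cast (R := ZMod (2 * k))) (by omega)
      rw [Nat.cast_add, Nat.cast_one] at h2
      rw [h2]
      exact_mod_cast h1
    rw [e, add_zero] at this
    exact Tj this
  · have stepS : ∀ q, ¬ Evn q → Cov a q → T (q - 2) := by
      intro q hq hS
      have h1 := H _ _ hS
      rw [dual_odd hq] at h1
      have hq1 : Evn (q - 1) := (evn_pred q).2 hq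
      have h2 := Tev _ hq1 (ST _ (ne1 _ (by tauto)) h1)
      have e : q - 1 - 1 = q - 2 := by ring
      rwa [e] at h2
    have odd2 : ∀ q : ZMod (2 * k), ¬ Evn q → ¬ Evn (q - 2) := by
      intro q hq
      have e : q - 2 = q - 1 - 1 := by ring
      rw [e, evn_pred, evn_pred]; tauto
    have key : ∀ t : ℕ, T (j - 2 * (t + 1)) ∧ ¬ Evn (j - 2 * ((t : ZMod (2 * k)) + 1)) := by
      intro t
      induction t with
      | zero => simpa using ⟨stepS j hj Sj, odd2 j hj⟩
      | succ t ih =>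
        have e : j - 2 * (((t + 1 : ℕ) : ZMod (2 * k)) + 1) = j - 2 * ((t : ZMod (2 * k)) + 1) - 2 := by
          push_cast; ring
        rw [e]
        exact ⟨stepS _ ih.2 (TS _ ih.1), odd2 _ ih.2⟩
    have := (key (k - 1)).1
    have e : (2 : ZMod (2 * k)) * (((k - 1 : ℕ) : ZMod (2 * k)) + 1) = 0 := by
      have h1 : ((2 * k : ℕ) : ZMod (2 * k)) = 0 := ZMod.natCast_self _
      have h2 : ((k - 1 + 1 : ℕ) : ZMod (2 * k)) = (k : ZMod (2 * k)) :=
        congrArg (Nat.cast (R := ZMod (2 * k))) (by omega)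
      rw [Nat.cast_add, Nat.cast_one] at h2
      rw [h2]
      exact_mod_cast h1
    rw [e, sub_zero] at this
    exact Tj this

end configs
end NSG

namespace NSG

theorem cyc_pair {N : ℕ} {G G' : Type} [Group G] [Group G'] (x : ZMod N → G) (y : ZMod N → G')
    (q : ZMod N) (t : ℕ) : cyc (fun i => (x i, y i)) q t = (cyc x q t, cyc y q t) := by
  induction t generalizing q with
  | zero => rfl
  | succ t ih => simp [cyc, ih]

theorem cyc_one_all {N : ℕ} [NeZero N] {G : Type} [Group G] (x : ZMod N → G) (p q : ZMod N)
    (h : cyc x p N = 1) : cyc x q N = 1 := by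
  obtain ⟨t, -, rfl⟩ := exists_shift p q
  induction t with
  | zero => simpa using h
  | succ t ih =>
    have := cyc_rot x (p + (t : ZMod N))
    rw [ih, one_mul] at this
    push_cast
    rw [← add_assoc]
    simpa using this

section step
variable {k n : ℕ} [NeZero k] {Q : Type} [Group Q]

theorem newcell {Z : Type} {EdZ : Z → Fin k → Z → Prop} (det : Det EdZ) {z0 : Z}
    (conn : ∀ z, ∃ g, GPath (EdSt EdZ) z0 g z) (gz : ZMod (2 * k) → Z) (p : ZMod (2 * k))
    (hgz : ∀ q, q ≠ p → EdZ (gz q) (lab q) (gz (q + 1)))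
    (hfull : ∀ g, GPath (EdSt (fun v i w => EdZ v i w ∨
      (v = gz p ∧ i = lab p ∧ w = gz (p + 1)))) z0 g z0) :
    ∃ (u : ZMod (2 * k) → Z) (j : ZMod (2 * k)) (b : Z),
      (∀ q, q ≠ j - 1 → EdZ (u q) (lab q) (u (q + 1))) ∧
      EdZ (u (j - 1)) (lab (j - 1)) b ∧ (∀ g, GPath (JSt EdZ (u j) b) z0 g z0) := by
  by_cases h1 : ∃ z, EdZ (gz p) (lab p) z
  · obtain ⟨z, hz⟩ := h1
    refine ⟨gz, p + 1, z, ?_, ?_, ?_⟩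
    · intro q hq
      rw [add_sub_cancel_right] at hq
      exact hgz q hq
    · rw [add_sub_cancel_right]; exact hz
    · intro g
      refine GPath.mono ?_ (hfull g)
      rintro v g w ⟨i, rfl, h | ⟨rfl, rfl, rfl⟩⟩
      · exact GPath.single (Or.inl ⟨i, rfl, h⟩)
      · have t1 : GPath (JSt EdZ (gz (p + 1)) z) (gz p) (FreeGroup.of (lab p)) z :=
          GPath.single (Or.inl ⟨_, rfl, hz⟩)
        have t2 : GPath (JSt EdZ (gz (p + 1)) z) z (1 : FreeGroup (Fin k))⁻¹ (gz (p + 1)) :=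
          GPath.single_inv (Or.inr ⟨rfl, rfl, rfl⟩)
        simpa using t1.trans t2
  by_cases h2 : ∃ z, EdZ z (lab p) (gz (p + 1))
  · obtain ⟨z, hz⟩ := h2
    have hp1 : p - 1 ≠ p := by
      intro h
      apply succ_ne (p - 1)
      rw [sub_add_cancel, h]
    refine ⟨Function.update gz p z, p, gz p, ?_, ?_, ?_⟩
    · intro q hq
      by_cases hqp : q = p
      · subst hqp
        rw [Function.update_self, Function.update_of_ne (succ_ne q)]
        exact hz
      · rw [Function.update_of_ne hqp, Function.update_of_ne]
        · exact hgz q hqp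
        · rintro rfl
          exact hq (by ring)
    · rw [Function.update_of_ne hp1]
      have := hgz (p - 1) hp1
      rwa [sub_add_cancel] at this
    · intro g
      rw [Function.update_self]
      refine GPath.mono ?_ (hfull g)
      rintro v g w ⟨i, rfl, h | ⟨rfl, rfl, rfl⟩⟩
      · exact GPath.single (Or.inl ⟨i, rfl, h⟩)
      · have t1 : GPath (JSt EdZ z (gz p)) z (FreeGroup.of (lab p)) (gz (p + 1)) :=
          GPath.single (Or.inl ⟨_, rfl, hz⟩)
        have t2 : GPath (JSt EdZ z (gz p)) (gz p) (1 : FreeGroup (Fin k))⁻¹ z :=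
          GPath.single_inv (Or.inr ⟨rfl, rfl, rfl⟩)
        simpa using t2.trans t1
  · exfalso
    have det2 : Det (fun v i w => EdZ v i w ∨ (v = gz p ∧ i = lab p ∧ w = gz (p + 1))) := by
      constructor
      · rintro v i w w' (h | ⟨rfl, rfl, rfl⟩) (h' | ⟨h3, h4, h5⟩)
        · exact det.1 _ _ _ _ h h'
        · subst h3 h4; exact absurd ⟨_, h⟩ h1
        · exact absurd ⟨_, h'⟩ h1
        · exact h5.symm
      · rintro v v' i w (h | ⟨rfl, rfl, rfl⟩) (h' | ⟨h3, h4, h5⟩)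
        · exact det.2 _ _ _ _ h h'
        · subst h4 h5; exact absurd ⟨_, h⟩ h2
        · exact absurd ⟨_, h'⟩ h2
        · exact h3.symm
    have all : ∀ z, z = z0 := by
      intro z
      obtain ⟨g, hg⟩ := conn z
      refine det_end det2 (GPath.mono ?_ hg) (hfull g)
      rintro v g w ⟨i, rfl, h⟩
      exact GPath.single ⟨i, rfl, Or.inl h⟩
    have := hgz (dual p) (dual_ne p)
    rw [lab_dual, all (gz (dual p)), ← all (gz p)] at this
    exact h1 ⟨_, this⟩

/-- Removing an edge. -/
def remEd {V : Type} (Ed : V → Fin k → V → Prop) (ve : V) (l : Fin k) : V → Fin k → V → Prop :=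
  fun v i w => Ed v i w ∧ ¬ (v = ve ∧ i = l)

open Classical in
/-- Labels after rerouting the edge. -/
noncomputable def kap {V : Type} (ve : V) (p : ZMod (2 * k)) (v : V) (i : Fin k) :
    FreeGroup (Fin k) :=
  if v = ve ∧ i = lab p then (W (p + 1) (2 * k - 1))⁻¹ else FreeGroup.of i

theorem noncross {V : Type} {ve : V} {p : ZMod (2 * k)} (f : ZMod (2 * k) → V)
    (hf : f (dual p) ≠ ve) {q : ZMod (2 * k)} (hq : f q = ve ∧ lab q = lab p) : q = p := by
  rcases lab_eq hq.2 with h | h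
  · exact h
  · rw [h] at hq; exact absurd hq.1 hf

theorem cyc_kap_cross {V : Type} {ve : V} {p : ZMod (2 * k)} (f : ZMod (2 * k) → V)
    (hf : f (dual p) ≠ ve) (hp : f p = ve) (q : ZMod (2 * k)) :
    cyc (fun i => kap ve p (f i) (lab i)) q (2 * k) = 1 := by
  apply cyc_one_all _ (p + 1)
  have hk0 : k ≠ 0 := NeZero.ne k
  obtain ⟨N, hN⟩ : ∃ N, 2 * k = N + 1 := ⟨2 * k - 1, by omega⟩
  have hN' : 2 * k - 1 = N := by omega
  have e0 : ((N : ℕ) : ZMod (2 * k)) + 1 = 0 := by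
    have : ((N + 1 : ℕ) : ZMod (2 * k)) = 0 := by
      rw [ZMod.natCast_eq_zero_iff, hN]
    push_cast at this
    exact this
  have e1 : p + 1 + (N : ZMod (2 * k)) = p := by
    rw [add_assoc, add_comm (1 : ZMod (2 * k)), e0, add_zero]
  have e2 : cyc (fun i => kap ve p (f i) (lab i)) (p + 1) N = W (p + 1) N := by
    apply cyc_congr
    intro i hi
    simp only [kap]
    rw [if_neg]
    intro h
    have h1 := noncross f hf h
    have := shift_ne p (i + 1) (by omega) (by omega)
    apply this
    push_cast
    rw [add_comm (i : ZMod (2 * k)), ← add_assoc, h1]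
  have e3 : ∀ M, M = N + 1 → cyc (fun i => kap ve p (f i) (lab i)) (p + 1) M = 1 := by
    rintro M rfl
    rw [cyc_add, e2, cyc_one, e1, kap, if_pos ⟨hp, rfl⟩, hN', mul_inv_cancel]
  exact e3 _ hN

theorem cyc_kap_nocross {V : Type} {ve : V} {p : ZMod (2 * k)} (f : ZMod (2 * k) → V)
    (hf : f (dual p) ≠ ve) (hp : f p ≠ ve) (q : ZMod (2 * k)) (t : ℕ) :
    cyc (fun i => kap ve p (f i) (lab i)) q t = W q t := by
  apply cyc_congr
  intro i hi
  simp only [kap]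
  rw [if_neg]
  intro h
  have h1 := noncross f hf h
  rw [h1] at h
  exact hp h.1

theorem gen_lemma {V : Type} {Ed REd : V → Fin k → V → Prop} (hd : Det Ed)
    {κ : V → Fin k → FreeGroup (Fin k)}
    (hκ : ∀ v i w, REd v i w → Ed v i w ∧ κ v i = FreeGroup.of i) {v0 a b : V}
    (B : Subgroup (FreeGroup (Fin k))) (A : Set (FreeGroup (Fin k)))
    (hA : ∀ g, GPath (EdSt Ed) v0 g v0 → g ∈ Subgroup.closure A)
    (hAB : ∀ g ∈ A, ∃ h, GPath (RSt Ed κ) v0 (g, h) v0 ∧ h ∈ B)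
    {g' hJ g0 π0 : FreeGroup (Fin k)} (J1 : GPath (RSt Ed κ) a (g', hJ) b)
    (J2 : GPath (RSt Ed κ) v0 (g0, π0) a) (J3 : π0 * hJ * π0⁻¹ ∈ B)
    (g : FreeGroup (Fin k)) (hg : GPath (JSt REd a b) v0 g v0) : g ∈ B := by
  have c1 : ∀ g h, GPath (RSt Ed κ) v0 (g, h) v0 → h ∈ B := by
    intro g h p
    have : ∃ h, GPath (RSt Ed κ) v0 (g, h) v0 ∧ h ∈ B := by
      refine Subgroup.closure_induction (p := fun g _ => ∃ h, GPath (RSt Ed κ) v0 (g, h) v0 ∧ h ∈ B)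
        ?_ ?_ ?_ ?_ (hA g (rpath_to_path κ p))
      · exact hAB
      · exact ⟨1, GPath.nil v0, B.one_mem⟩
      · rintro x y _ _ ⟨h, p, hB⟩ ⟨h', p', hB'⟩
        exact ⟨h * h', p.trans p', B.mul_mem hB hB'⟩
      · rintro x _ ⟨h, p, hB⟩
        exact ⟨h⁻¹, p.symm, B.inv_mem hB⟩
    obtain ⟨h', p', hB⟩ := this
    rwa [rpath_unique hd κ p p']
  have c1' : ∀ v g1 h1 g2 h2, GPath (RSt Ed κ) v0 (g1, h1) v → GPath (RSt Ed κ) v0 (g2, h2) v →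
      h1 * h2⁻¹ ∈ B := fun v g1 h1 g2 h2 p1 p2 => c1 (g1 * g2⁻¹) _ (p1.trans p2.symm)
  have cJ : ∀ g1 h1, GPath (RSt Ed κ) v0 (g1, h1) a → h1 * hJ * h1⁻¹ ∈ B := by
    intro g1 h1 p1
    have t := c1' _ _ _ _ _ p1 J2
    have := B.mul_mem (B.mul_mem t J3) (B.inv_mem t)
    convert this using 1
    group
  have c2 : ∀ {v w q}, GPath (JSt REd a b) v q w → ∀ g1 πv g2 πw,
      GPath (RSt Ed κ) v0 (g1, πv) v → GPath (RSt Ed κ) v0 (g2, πw) w → πv * q * πw⁻¹ ∈ B := by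
    intro v w q path
    induction path with
    | nil v =>
      intro g1 πv g2 πw p1 p2
      rw [mul_one]
      exact c1' _ _ _ _ _ p1 p2
    | @fwd v w u g h s _ ih =>
      intro g1 πv g2 πw p1 p2
      rcases s with ⟨i, rfl, he⟩ | ⟨rfl, rfl, rfl⟩
      · obtain ⟨he1, he2⟩ := hκ _ _ _ he
        have t : GPath (RSt Ed κ) v0 (g1 * FreeGroup.of i, πv * FreeGroup.of i) w :=
          p1.trans (h := (FreeGroup.of i, FreeGroup.of i)) (GPath.single ⟨i, by rw [he2], he1⟩)
        have := ih _ _ _ _ t p2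
        rwa [mul_assoc πv] at this
      · have h1 := ih _ _ _ _ (p1.trans J1) p2
        have h2 := B.mul_mem (B.inv_mem (cJ _ _ p1)) h1
        convert h2 using 1
        group
    | @bwd v w u g h s _ ih =>
      intro g1 πv g2 πw p1 p2
      rcases s with ⟨i, rfl, he⟩ | ⟨rfl, rfl, rfl⟩
      · obtain ⟨he1, he2⟩ := hκ _ _ _ he
        have t : GPath (RSt Ed κ) v0 (g1 * (FreeGroup.of i)⁻¹, πv * (FreeGroup.of i)⁻¹) w :=
          p1.trans (h := (FreeGroup.of i, FreeGroup.of i)⁻¹)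
            (GPath.single_inv ⟨i, by rw [he2], he1⟩)
        have := ih _ _ _ _ t p2
        rwa [mul_assoc πv] at this
      · have p3 : GPath (RSt Ed κ) v0 (g1 * g'⁻¹, πv * hJ⁻¹) w := p1.trans J1.symm
        have h1 := ih _ _ _ _ p3 p2
        have h2 := B.mul_mem (cJ _ _ p3) h1
        convert h2 using 1
        group
  have := c2 hg 1 1 1 1 (GPath.nil v0) (GPath.nil v0)
  simpa using this

end step
end NSG

namespace NSG

section step2
variable {k n : ℕ} [NeZero k] {Q : Type} [Group Q]

theorem W_split (p : ZMod (2 * k)) :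
    FreeGroup.of (lab p) * W (p + 1) (2 * k - 1) = W p (2 * k) := by
  have hk0 : k ≠ 0 := NeZero.ne k
  have h := W_add p 1 (2 * k - 1)
  rw [W_one, Nat.cast_one] at h
  rw [← h]
  congr 1
  omega

theorem shift_last (p : ZMod (2 * k)) : p + ((2 * k - 1 : ℕ) : ZMod (2 * k)) = p - 1 := by
  have hk0 : k ≠ 0 := NeZero.ne k
  have : ((2 * k - 1 : ℕ) : ZMod (2 * k)) + 1 = 0 := by
    have h1 : ((2 * k - 1 + 1 : ℕ) : ZMod (2 * k)) = 0 := by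
      rw [ZMod.natCast_eq_zero_iff]
      have : 2 * k - 1 + 1 = 2 * k := by omega
      rw [this]
    push_cast at h1
    exact h1
  rw [eq_neg_of_add_eq_zero_left this]
  ring

theorem K1 {V : Type} {Ed : V → Fin k → V → Prop} {ve : V} {p : ZMod (2 * k)}
    (ρ : FreeGroup (Fin k) →* Q) (hρ : ∀ q : ZMod (2 * k), ρ (W q (2 * k)) = 1) {v w : V}
    {x : FreeGroup (Fin k) × FreeGroup (Fin k)} (path : GPath (RSt Ed (kap ve p)) v x w) :
    ρ x.1 = ρ x.2 := by
  have st : ∀ v x w, RSt Ed (kap ve p) v x w → ρ x.1 = ρ x.2 := by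
    rintro v x w ⟨i, rfl, he⟩
    simp only [kap]
    split_ifs with h
    · rw [h.2, map_inv, eq_inv_iff_mul_eq_one, ← map_mul, W_split, hρ]
    · rfl
  induction path with
  | nil v => rfl
  | fwd s _ ih => rw [Prod.fst_mul, Prod.snd_mul, map_mul, map_mul, ih, st _ _ _ s]
  | bwd s _ ih =>
    rw [Prod.fst_mul, Prod.snd_mul, map_mul, map_mul, ih, Prod.fst_inv, Prod.snd_inv,
      map_inv, map_inv, st _ _ _ s]

theorem K2 {V : Type} {Ed : V → Fin k → V → Prop} (det : Det Ed) {ve we a b : V}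
    {p : ZMod (2 * k)} (he : Ed ve (lab p) we)
    (g : ZMod (2 * k) → V) (hgp : g p = ve)
    (g1 : ∀ q, q ≠ p → GPath (JSt (remEd Ed ve (lab p)) a b) (g q) (FreeGroup.of (lab q)) (g (q + 1)))
    (g2 : GPath (JSt (remEd Ed ve (lab p)) a b) we 1 (g (p + 1))) {v w : V}
    {x : FreeGroup (Fin k) × FreeGroup (Fin k)} (path : GPath (RSt Ed (kap ve p)) v x w) :
    GPath (JSt (remEd Ed ve (lab p)) a b) v x.2 w := by
  have hk0 : k ≠ 0 := NeZero.ne k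
  have y : GPath (JSt (remEd Ed ve (lab p)) a b) (g (p + 1)) (W (p + 1) (2 * k - 1)) ve := by
    have := cyc_path (St := JSt (remEd Ed ve (lab p)) a b) g (fun i => FreeGroup.of (lab i))
      (p + 1) (2 * k - 1) (by
        intro i hi
        apply g1
        have := shift_ne p (i + 1) (by omega) (by omega)
        push_cast at this
        rwa [add_assoc, add_comm (1 : ZMod (2 * k))])
    rw [shift_last, add_sub_cancel_right, hgp] at this
    exact this
  refine GPath.map id (MonoidHom.snd _ _) ?_ path
  rintro v x w ⟨i, rfl, hE⟩
  simp only [MonoidHom.coe_snd, id, kap]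
  split_ifs with h
  · obtain ⟨rfl, rfl⟩ := h
    have e : w = we := det.1 _ _ _ _ hE he
    subst e
    have := (g2.trans y).symm
    simpa using this
  · exact GPath.single (Or.inl ⟨i, rfl, hE, h⟩)

theorem step_core {V : Type} [Finite V] {ρ : FreeGroup (Fin k) →* Q} {φ : FreeGroup (Fin n) →* Q}
    {s : ℕ} {Ed : V → Fin k → V → Prop} {v0 : V} {ψ : FreeGroup (Fin n) →* FreeGroup (Fin k)}
    {S : Finset (FreeGroup (Fin k))} {u : ZMod (2 * k) → V} {j : ZMod (2 * k)} {b : V}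
    (cfg : Config ρ φ s V Ed v0 ψ S u j b) (hρ : ∀ q : ZMod (2 * k), ρ (W q (2 * k)) = 1)
    (hab : u j ≠ b) {ve we : V} {p : ZMod (2 * k)} (he : Ed ve (lab p) we)
    (g : ZMod (2 * k) → V) (hgp : g p = ve)
    (g1 : ∀ q, q ≠ p →
      GPath (JSt (remEd Ed ve (lab p)) (u j) b) (g q) (FreeGroup.of (lab q)) (g (q + 1)))
    (g2 : GPath (JSt (remEd Ed ve (lab p)) (u j) b) we 1 (g (p + 1)))
    (S' : Finset (FreeGroup (Fin k))) (hS' : S'.card ≤ s)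
    (hcyc : ∀ m ∈ S', ∃ cz : ZMod (2 * k) → V,
      (∀ q, GPath (JSt (remEd Ed ve (lab p)) (u j) b) (cz q) (FreeGroup.of (lab q)) (cz (q + 1))) ∧
      ∃ q τ, GPath (JSt (remEd Ed ve (lab p)) (u j) b) v0 τ (cz q) ∧ m = τ * W q (2 * k) * τ⁻¹)
    (hSS : ∀ m ∈ S, ∃ h, GPath (RSt Ed (kap ve p)) v0 (m, h) v0 ∧
      h ∈ Subgroup.closure (S' : Set (FreeGroup (Fin k))))
    {g' hJ g0 π0 : FreeGroup (Fin k)} (J1 : GPath (RSt Ed (kap ve p)) (u j) (g', hJ) b)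
    (J2 : GPath (RSt Ed (kap ve p)) v0 (g0, π0) (u j))
    (J3 : π0 * hJ * π0⁻¹ ∈ Subgroup.closure (S' : Set (FreeGroup (Fin k)))) :
    ∃ (Z : Type) (_ : Finite Z) (Ed' : Z → Fin k → Z → Prop) (z0 : Z)
      (ψ' : FreeGroup (Fin n) →* FreeGroup (Fin k)) (S' : Finset (FreeGroup (Fin k)))
      (u' : ZMod (2 * k) → Z) (j' : ZMod (2 * k)) (b' : Z),
      Config ρ φ s Z Ed' z0 ψ' S' u' j' b' ∧ Nat.card Z < Nat.card V := by
  classical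
  set M := JSt (remEd Ed ve (lab p)) (u j) b with hM
  have k2 : ∀ {v w x}, GPath (RSt Ed (kap ve p)) v x w → GPath M v x.2 w :=
    fun path => K2 cfg.det he g hgp g1 g2 path
  have hMl : ∀ v g w, M v g w → g = 1 ∨ ∃ i, g = FreeGroup.of i := by
    rintro v g w (⟨i, rfl, _⟩ | ⟨_, rfl, _⟩)
    · exact Or.inr ⟨i, rfl⟩
    · exact Or.inl rfl
  -- the new lift
  have lft : ∀ i : Fin n, ∃ h, GPath (RSt Ed (kap ve p)) v0 (ψ (FreeGroup.of i), h) v0 :=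
    fun i => path_to_rpath _ (cfg.loop _)
  choose hl hhl using lft
  set ψ' : FreeGroup (Fin n) →* FreeGroup (Fin k) := FreeGroup.lift hl with hψ'
  have rr : ∀ x, GPath (RSt Ed (kap ve p)) v0 (ψ x, ψ' x) v0 := by
    intro x
    induction x using FreeGroup.induction_on with
    | C1 => rw [map_one, map_one]; exact GPath.nil v0
    | of i => simpa [hψ'] using hhl i
    | inv_of i ih => rw [map_inv, map_inv]; exact ih.symm
    | mul x y hx hy => rw [map_mul, map_mul]; exact hx.trans hy
  have letter : ∀ {v w i}, GPath M v (FreeGroup.of i) w → FoldEd M (fmk M v) i (fmk M w) :=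
    fun path => det_letter (fold_det M) (fold_path hMl path)
  have conn : ∀ z, ∃ g, GPath (EdSt (FoldEd M)) (fmk M v0) g z := by
    intro z
    obtain ⟨v, rfl⟩ := fmk_surj z
    obtain ⟨g, hg⟩ := cfg.conn v
    obtain ⟨h, hh⟩ := path_to_rpath (kap ve p) hg
    exact ⟨h, fold_path hMl (k2 hh)⟩
  have hub : fmk M (u j) = fmk M b := fmk_eq.2 (GPath.single (Or.inr ⟨rfl, rfl, rfl⟩))
  have hwe : fmk M we = fmk M (g (p + 1)) := fmk_eq.2 g2
  obtain ⟨u', j', b', n1, n2, n3⟩ := newcell (fold_det M) conn (fun q => fmk M (g q)) p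
    (fun q hq => letter (g1 q hq)) (by
      intro x
      refine GPath.map (fmk M) (MonoidHom.id _) ?_ (cfg.full x)
      rintro v x w (⟨i, rfl, h⟩ | ⟨rfl, rfl, rfl⟩)
      · refine GPath.single ⟨i, rfl, ?_⟩
        by_cases hc : v = ve ∧ i = lab p
        · right
          obtain ⟨rfl, rfl⟩ := hc
          refine ⟨by rw [hgp], rfl, ?_⟩
          rw [← hwe, cfg.det.1 _ _ _ _ h he]
        · left
          exact ⟨v, w, rfl, rfl, Or.inl ⟨i, rfl, h, hc⟩⟩
      · rw [hub]; exact GPath.nil _)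
  refine ⟨FoldV M, inferInstance, FoldEd M, fmk M v0, ψ', S', u', j', b', ?_, ?_⟩
  · refine ⟨fold_det M, conn, ?_, ?_, hS', ?_, ?_, n1, n2, n3⟩
    · rw [← cfg.lift]
      ext i
      exact (K1 ρ hρ (rr (FreeGroup.of i))).symm
    · intro x
      exact fold_path hMl (k2 (rr x))
    · intro m hm
      obtain ⟨cz, h1, q, τ, h2, h3⟩ := hcyc m hm
      exact ⟨fun q => fmk M (cz q), fun q => letter (h1 q), q, τ, fold_path hMl h2, h3⟩
    · intro x hx
      have hx' := fold_path_inv hx v0 v0 rfl rfl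
      have sub : Subgroup.closure (S' : Set (FreeGroup (Fin k))) ≤
        Subgroup.closure (Set.range ψ' ∪ (S' : Set (FreeGroup (Fin k)))) :=
        Subgroup.closure_mono Set.subset_union_right
      refine gen_lemma (REd := remEd Ed ve (lab p)) cfg.det (κ := kap ve p) ?_ _ _ cfg.gen ?_ J1 J2 (sub J3) x hx'
      · rintro v i w ⟨h1, h2⟩
        exact ⟨h1, by simp only [kap]; rw [if_neg h2]⟩
      · rintro y (⟨x, rfl⟩ | hy)
        · exact ⟨_, rr x, Subgroup.subset_closure (Or.inl ⟨x, rfl⟩)⟩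
        · obtain ⟨h, h1, h2⟩ := hSS y hy
          exact ⟨h, h1, sub h2⟩
  · have := Fintype.ofFinite V
    have := Fintype.ofFinite (FoldV M)
    rw [Nat.card_eq_fintype_card, Nat.card_eq_fintype_card]
    refine Fintype.card_lt_of_surjective_not_injective (fmk M) (fun z => fmk_surj z) ?_
    intro hi
    exact hab (hi hub)

end step2
end NSG

namespace NSG

section step3
variable {k n : ℕ} [NeZero k] {Q : Type} [Group Q]

/-- A cycle of edges read with doubled labels. -/
theorem cycle_rpath {V : Type} {Ed : V → Fin k → V → Prop} (κ : V → Fin k → FreeGroup (Fin k))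
    (c : ZMod (2 * k) → V) (q : ZMod (2 * k)) (t : ℕ)
    (hc : ∀ i : ℕ, i < t → Ed (c (q + i)) (lab (q + i)) (c (q + i + 1))) :
    GPath (RSt Ed κ) (c q) (W q t, cyc (fun i => κ (c i) (lab i)) q t) (c (q + t)) := by
  have := cyc_path (St := RSt Ed κ) c (fun i => (FreeGroup.of (lab i), κ (c i) (lab i))) q t
    (fun i hi => GPath.single ⟨_, rfl, hc i hi⟩)
  rw [cyc_pair] at this
  exact this

theorem Config.step {V : Type} [Finite V] {ρ : FreeGroup (Fin k) →* Q}
    {φ : FreeGroup (Fin n) →* Q}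
    {s : ℕ} {Ed : V → Fin k → V → Prop} {v0 : V} {ψ : FreeGroup (Fin n) →* FreeGroup (Fin k)}
    {S : Finset (FreeGroup (Fin k))} {u : ZMod (2 * k) → V} {j : ZMod (2 * k)} {b : V}
    (cfg : Config ρ φ s V Ed v0 ψ S u j b) (hρ : ∀ q : ZMod (2 * k), ρ (W q (2 * k)) = 1)
    (hab : u j ≠ b) :
    ∃ (Z : Type) (_ : Finite Z) (Ed' : Z → Fin k → Z → Prop) (z0 : Z)
      (ψ' : FreeGroup (Fin n) →* FreeGroup (Fin k)) (S' : Finset (FreeGroup (Fin k)))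
      (u' : ZMod (2 * k) → Z) (j' : ZMod (2 * k)) (b' : Z),
      Config ρ φ s Z Ed' z0 ψ' S' u' j' b' ∧ Nat.card Z < Nat.card V := by
  classical
  have hk0 : k ≠ 0 := NeZero.ne k
  have : Nonempty (ZMod (2 * k) → V) := ⟨u⟩
  choose! c hc using cfg.cycles
  obtain ⟨ve, p, hin, hout⟩ := link cfg.det (c '' (S : Set (FreeGroup (Fin k))))
    (by rintro _ ⟨m, hm, rfl⟩; exact (hc m hm).1) u j b cfg.cell1 cfg.cell2 hab
  push Not at hout
  have oc : ∀ m ∈ S, c m (dual p) ≠ ve := fun m hm => hout.1 _ ⟨m, hm, rfl⟩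
  have ou : u (dual p) ≠ ve := hout.2
  set M := JSt (remEd Ed ve (lab p)) (u j) b with hM
  -- steps along the cell avoiding the edge
  have uM : ∀ q, ¬ (u q = ve ∧ lab q = lab p) → GPath M (u q) (FreeGroup.of (lab q)) (u (q + 1)) := by
    intro q hq
    by_cases hj : q = j - 1
    · subst hj
      have t1 : GPath M (u (j - 1)) (FreeGroup.of (lab (j - 1))) b :=
        GPath.single (Or.inl ⟨_, rfl, cfg.cell2, hq⟩)
      have t2 : GPath M b (1 : FreeGroup (Fin k))⁻¹ (u j) :=
        GPath.single_inv (Or.inr ⟨rfl, rfl, rfl⟩)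
      rw [sub_add_cancel]
      simpa using t1.trans t2
    · exact GPath.single (Or.inl ⟨_, rfl, cfg.cell1 q hj, hq⟩)
  have cM : ∀ m ∈ S, ∀ q, ¬ (c m q = ve ∧ lab q = lab p) →
      GPath M (c m q) (FreeGroup.of (lab q)) (c m (q + 1)) :=
    fun m hm q hq => GPath.single (Or.inl ⟨_, rfl, (hc m hm).1 q, hq⟩)
  -- the images of the old generators
  have hm0 : ∀ m ∈ S, ∃ h, GPath (RSt Ed (kap ve p)) v0 (m, h) v0 ∧
      (c m p = ve → h = 1) ∧
      (c m p ≠ ve → ∃ q τ x, GPath (RSt Ed (kap ve p)) v0 (x, τ) (c m q) ∧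
        h = τ * W q (2 * k) * τ⁻¹) := by
    intro m hm
    obtain ⟨h1, q, τ, h2, h3⟩ := hc m hm
    obtain ⟨τ', h4⟩ := path_to_rpath (kap ve p) h2
    have h5 := cycle_rpath (Ed := Ed) (kap ve p) (c m) q (2 * k) (fun i _ => h1 _)
    rw [ZMod.natCast_self, add_zero] at h5
    have h6 := (h4.trans h5).trans h4.symm
    have e : ((τ, τ') * (W q (2 * k), cyc (fun i => kap ve p (c m i) (lab i)) q (2 * k)) * (τ, τ')⁻¹)
        = (m, τ' * cyc (fun i => kap ve p (c m i) (lab i)) q (2 * k) * τ'⁻¹) :=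
      Prod.ext h3.symm rfl
    rw [e] at h6
    refine ⟨_, h6, ?_, ?_⟩
    · intro hp
      rw [cyc_kap_cross _ (oc m hm) hp]
      simp
    · intro hp
      refine ⟨q, τ', τ, h4, ?_⟩
      rw [cyc_kap_nocross _ (oc m hm) hp]
  choose! hm hm1 hm2 hm3 using hm0
  set S1 := S.filter (fun m => c m p ≠ ve) with hS1
  -- the jump
  obtain ⟨g0, hg0⟩ := cfg.conn (u j)
  obtain ⟨π0, J2⟩ := path_to_rpath (kap ve p) hg0
  have J1 : GPath (RSt Ed (kap ve p)) (u j)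
      (W j (2 * k), cyc (fun i => kap ve p (u i) (lab i)) j (2 * k)) b := by
    have h1 := cycle_rpath (Ed := Ed) (kap ve p) u j (2 * k - 1) (fun i hi => by
      apply cfg.cell1
      intro h
      have := shift_ne j (i + 1) (by omega) (by omega)
      apply this
      push_cast
      rw [← add_assoc, h]; ring)
    rw [shift_last] at h1
    have h2 : GPath (RSt Ed (kap ve p)) (u (j - 1))
      (FreeGroup.of (lab (j - 1)), kap ve p (u (j - 1)) (lab (j - 1))) b :=
      GPath.single ⟨_, rfl, cfg.cell2⟩
    have h3 := h1.trans h2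
    have e : ∀ {G : Type} [Group G] (x : ZMod (2 * k) → G),
        cyc x j (2 * k) = cyc x j (2 * k - 1) * x (j - 1) := by
      intro G _ x
      have := cyc_add x j (2 * k - 1) 1
      rw [cyc_one, shift_last] at this
      rw [← this]
      congr 1
      omega
    have e1 : W j (2 * k) = W j (2 * k - 1) * FreeGroup.of (lab (j - 1)) :=
      e (fun i => FreeGroup.of (lab i))
    rw [e1, e]
    exact h3
  -- cycles for the surviving generators
  have surv : (∀ {v w x}, GPath (RSt Ed (kap ve p)) v x w → GPath M v x.2 w) →
      ∀ m ∈ S1.image hm, ∃ cz : ZMod (2 * k) → V,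
      (∀ q, GPath M (cz q) (FreeGroup.of (lab q)) (cz (q + 1))) ∧
      ∃ q τ, GPath M v0 τ (cz q) ∧ m = τ * W q (2 * k) * τ⁻¹ := by
    intro k2 m' hm'
    obtain ⟨m, hmS1, rfl⟩ := Finset.mem_image.1 hm'
    obtain ⟨hmS, hmp⟩ := Finset.mem_filter.1 hmS1
    obtain ⟨q, τ, x, h1, h2⟩ := hm3 m hmS hmp
    refine ⟨c m, fun q => cM m hmS q ?_, q, τ, k2 h1, h2⟩
    intro hq
    have := noncross (c m) (oc m hmS) hq
    subst this
    exact hmp hq.1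
  have hSS : ∀ T : Finset (FreeGroup (Fin k)), S1.image hm ⊆ T → ∀ m ∈ S, ∃ h,
      GPath (RSt Ed (kap ve p)) v0 (m, h) v0 ∧
      h ∈ Subgroup.closure (T : Set (FreeGroup (Fin k))) := by
    intro T hT m hmS
    refine ⟨hm m, hm1 m hmS, ?_⟩
    by_cases h : c m p = ve
    · rw [hm2 m hmS h]; exact Subgroup.one_mem _
    · exact Subgroup.subset_closure (hT (Finset.mem_image_of_mem _ (Finset.mem_filter.2 ⟨hmS, h⟩)))
  by_cases hup : u p = ve
  · -- the cell crosses the edge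
    have g1 : ∀ q, q ≠ p → GPath M (u q) (FreeGroup.of (lab q)) (u (q + 1)) :=
      fun q hq => uM q (fun h => hq (noncross u ou h))
    have hwe : ∃ we, Ed ve (lab p) we ∧ GPath M we 1 (u (p + 1)) := by
      by_cases hj : p = j - 1
      · refine ⟨b, ?_, ?_⟩
        · rw [← hup, hj]; exact cfg.cell2
        · have t2 : GPath M b (1 : FreeGroup (Fin k))⁻¹ (u j) :=
            GPath.single_inv (Or.inr ⟨rfl, rfl, rfl⟩)
          rw [hj, sub_add_cancel]
          simpa using t2
      · exact ⟨u (p + 1), hup ▸ cfg.cell1 p hj, GPath.nil _⟩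
    obtain ⟨we, he, g2⟩ := hwe
    refine step_core cfg hρ hab he u hup g1 g2 (S1.image hm) ?_
      (surv fun path => K2 cfg.det he u hup g1 g2 path) (hSS _ subset_rfl) J1 J2 ?_
    · exact (Finset.card_image_le.trans (Finset.card_filter_le _ _)).trans cfg.card
    · rw [cyc_kap_cross u ou hup]
      simp
  · obtain ⟨m0, hm0S, hm0p⟩ : ∃ m ∈ S, c m p = ve := by
      rcases hin with ⟨_, ⟨m, hm, rfl⟩, h⟩ | h
      · exact ⟨m, hm, h⟩
      · exact absurd h hup
    have g1 : ∀ q, q ≠ p → GPath M (c m0 q) (FreeGroup.of (lab q)) (c m0 (q + 1)) :=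
      fun q hq => cM m0 hm0S q (fun h => hq (noncross _ (oc m0 hm0S) h))
    have he : Ed ve (lab p) (c m0 (p + 1)) := hm0p ▸ (hc m0 hm0S).1 p
    have g2 : GPath M (c m0 (p + 1)) 1 (c m0 (p + 1)) := GPath.nil _
    have k2 : ∀ {v w x}, GPath (RSt Ed (kap ve p)) v x w → GPath M v x.2 w :=
      fun path => K2 cfg.det he (c m0) hm0p g1 g2 path
    refine step_core cfg hρ hab he (c m0) hm0p g1 g2
      (insert (π0 * W j (2 * k) * π0⁻¹) (S1.image hm)) ?_ ?_
      (hSS _ (Finset.subset_insert _ _)) J1 J2 ?_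
    · refine (Finset.card_insert_le _ _).trans ?_
      have h1 : S1.card < S.card := Finset.card_lt_card (by
        rw [Finset.ssubset_iff_of_subset (Finset.filter_subset _ _)]
        exact ⟨m0, hm0S, fun h => (Finset.mem_filter.1 h).2 hm0p⟩)
      have h2 : (S1.image hm).card ≤ S1.card := Finset.card_image_le
      have := cfg.card
      omega
    · intro m hm'
      rcases Finset.mem_insert.1 hm' with rfl | hm'
      · refine ⟨u, fun q => uM q ?_, j, π0, k2 J2, rfl⟩
        intro hq
        have := noncross u ou hq
        subst this
        exact hup hq.1
      · exact surv k2 m hm'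
    · rw [cyc_kap_nocross u ou hup]
      exact Subgroup.subset_closure (Finset.mem_insert_self _ _)

theorem Config.concl {ρ : FreeGroup (Fin k) →* Q} {φ : FreeGroup (Fin n) →* Q} {s : ℕ}
    (hρ : ∀ q : ZMod (2 * k), ρ (W q (2 * k)) = 1) (hmain : MainP ρ φ s) (N : ℕ) :
    ∀ {V : Type} [Finite V] {Ed : V → Fin k → V → Prop} {v0 : V}
    {ψ : FreeGroup (Fin n) →* FreeGroup (Fin k)}
    {S : Finset (FreeGroup (Fin k))} {u : ZMod (2 * k) → V} {j : ZMod (2 * k)} {b : V}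
    (_ : Config ρ φ s V Ed v0 ψ S u j b), Nat.card V = N → Concl ρ φ := by
  induction N using Nat.strong_induction_on with
  | _ N ih =>
    intro V _ Ed v0 ψ S u j b cfg hN
    by_cases hab : u j = b
    · refine hmain ψ S cfg.lift cfg.card ?_ ?_
      · intro m hm
        obtain ⟨c, _, q, τ, _, h⟩ := cfg.cycles m hm
        exact ⟨q, τ, h⟩
      · intro g
        apply cfg.gen
        refine GPath.mono ?_ (cfg.full g)
        rintro v g w (h | ⟨rfl, rfl, rfl⟩)
        · exact GPath.single h
        · rw [hab]; exact GPath.nil _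
    · obtain ⟨Z, hZ, Ed', z0, ψ', S', u', j', b', cfg', hlt⟩ := cfg.step hρ hab
      exact ih _ (hN ▸ hlt) cfg' rfl

end step3
end NSG

namespace NSG

section ball
variable {k n : ℕ}

/-- The ball of radius `N` in the free group. -/
abbrev BV (k N : ℕ) : Type := {g : FreeGroup (Fin k) // g.norm ≤ N}

instance BV.finite (N : ℕ) : Finite (BV k N) := by
  have hf : Set.Finite {L : List (Fin k × Bool) | L.length ≤ N} := List.finite_length_le _ _
  have : Finite {L : List (Fin k × Bool) // L.length ≤ N} := hf.to_subtype
  refine Finite.of_injective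
    (fun g : BV k N => (⟨g.1.toWord, g.2⟩ : {L : List (Fin k × Bool) // L.length ≤ N})) ?_
  intro g h e
  apply Subtype.ext
  exact FreeGroup.toWord_injective (congrArg Subtype.val e)

/-- The origin. -/
def BV.o (N : ℕ) : BV k N := ⟨1, by simp⟩

theorem ball_path {N : ℕ} {St : BV k N → FreeGroup (Fin k) → BV k N → Prop}
    (hSt : ∀ (v w : BV k N) i, w.1 = v.1 * FreeGroup.of i → St v (FreeGroup.of i) w)
    (v : BV k N) : GPath St (BV.o N) v.1 v := by
  have key : ∀ L : List (Fin k × Bool), L.length ≤ N → ∀ v : BV k N, v.1 = FreeGroup.mk L →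
      GPath St (BV.o N) v.1 v := by
    intro L
    induction L using List.reverseRecOn with
    | nil =>
      intro _ v hv
      have : v = BV.o N := Subtype.ext hv
      subst this
      exact GPath.nil _
    | append_singleton L x ih =>
      intro hL v hv
      rw [List.length_append, List.length_singleton] at hL
      obtain ⟨i, bb⟩ := x
      set w : BV k N := ⟨FreeGroup.mk L, FreeGroup.norm_mk_le.trans (by omega)⟩ with hw
      have hi := ih (by omega) w rfl
      have e : v.1 = w.1 * FreeGroup.mk [(i, bb)] := by
        rw [hv, hw]; exact FreeGroup.mul_mk.symm
      rw [e]
      refine hi.trans ?_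
      cases bb with
      | true => exact GPath.single (hSt _ _ _ e)
      | false =>
        have e2 : (FreeGroup.mk [(i, false)] : FreeGroup (Fin k)) = (FreeGroup.of i)⁻¹ := rfl
        rw [e2] at e ⊢
        exact GPath.single_inv (hSt _ _ _ (by rw [e]; simp))
  exact key v.1.toWord v.2 v FreeGroup.mk_toWord.symm

end ball

section initial
variable {k n : ℕ} [NeZero k] {Q : Type} [Group Q]

/-- The vertices along a translated relator. -/
def cellf (τ : FreeGroup (Fin k)) (q q' : ZMod (2 * k)) : FreeGroup (Fin k) :=
  τ * W q (q' - q).val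

theorem cellf_self (τ : FreeGroup (Fin k)) (q : ZMod (2 * k)) : cellf τ q q = τ := by
  simp [cellf, W, cyc]

theorem cellf_mul (τ : FreeGroup (Fin k)) (q q' : ZMod (2 * k)) :
    cellf τ q q' * FreeGroup.of (lab q') = τ * W q ((q' - q).val + 1) := by
  rw [W_add, W_one, cellf, mul_assoc]
  congr 4
  simp

theorem cellf_succ (τ : FreeGroup (Fin k)) (q q' : ZMod (2 * k)) (h : q' ≠ q - 1) :
    cellf τ q (q' + 1) = cellf τ q q' * FreeGroup.of (lab q') := by
  rw [cellf_mul, cellf]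
  have e : q' + 1 - q = q' - q + 1 := by ring
  rw [e]
  rcases val_succ (q' - q) with h1 | h1
  · rw [h1.1]
  · exfalso
    apply h
    have := (ZMod.val_eq_zero _).1 h1.1
    linear_combination this

theorem cellf_last (τ : FreeGroup (Fin k)) (q : ZMod (2 * k)) :
    cellf τ q (q - 1) * FreeGroup.of (lab (q - 1)) = τ * W q (2 * k) := by
  rw [cellf_mul]
  rcases val_succ (q - 1 - q) with h1 | h1
  · exfalso
    have e : q - 1 - q + 1 = 0 := by ring
    rw [e, ZMod.val_zero] at h1
    omega
  · rw [h1.2]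

theorem main_step {ρ : FreeGroup (Fin k) →* Q} {φ : FreeGroup (Fin n) →* Q} {s : ℕ}
    (hρ : ∀ q : ZMod (2 * k), ρ (W q (2 * k)) = 1) (hmain : MainP ρ φ s) :
    MainP ρ φ (s + 1) := by
  classical
  intro ψ S hψ hS hconj hgen
  by_cases hle : S.card ≤ s
  · exact hmain ψ S hψ hle hconj hgen
  obtain ⟨m0, hm0⟩ : S.Nonempty := by
    rw [← Finset.card_pos]; omega
  choose! qf τf hf using hconj
  set S0 := S.erase m0 with hS0
  have hS0c : S0.card ≤ s := by
    rw [hS0, Finset.card_erase_of_mem hm0]; omega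
  set N := (S.sup fun m => (Finset.range (2 * k + 1)).sup fun t => (τf m * W (qf m) t).norm) +
    (Finset.univ.sup fun i : Fin n => (ψ (FreeGroup.of i)).norm) with hN
  have N1 : ∀ i : Fin n, (ψ (FreeGroup.of i)).norm ≤ N := fun i =>
    (Finset.le_sup (f := fun i : Fin n => (ψ (FreeGroup.of i)).norm) (Finset.mem_univ i)).trans
      (Nat.le_add_left _ _)
  have N2 : ∀ m ∈ S, ∀ t, t ≤ 2 * k → (τf m * W (qf m) t).norm ≤ N := by
    intro m hm t ht
    refine le_trans ?_ (Nat.le_add_right _ _)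
    refine le_trans ?_ (Finset.le_sup (f := fun m => (Finset.range (2 * k + 1)).sup
      fun t => (τf m * W (qf m) t).norm) hm)
    exact Finset.le_sup (f := fun t => (τf m * W (qf m) t).norm) (Finset.mem_range.2 (by omega))
  set St : BV k N → FreeGroup (Fin k) → BV k N → Prop := fun v g w =>
    (∃ i, g = FreeGroup.of i ∧ w.1 = v.1 * FreeGroup.of i) ∨
    (g = 1 ∧ w.1 = 1 ∧ ∃ i, v.1 = ψ (FreeGroup.of i)) ∨
    (g = 1 ∧ ∃ m ∈ S0, v.1 = τf m * W (qf m) (2 * k) ∧ w.1 = τf m) with hSt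
  have hStl : ∀ v g w, St v g w → g = 1 ∨ ∃ i, g = FreeGroup.of i := by
    rintro v g w (⟨i, h, _⟩ | ⟨h, _⟩ | ⟨h, _⟩)
    · exact Or.inr ⟨i, h⟩
    · exact Or.inl h
    · exact Or.inl h
  have edge : ∀ (v w : BV k N) i, w.1 = v.1 * FreeGroup.of i → St v (FreeGroup.of i) w :=
    fun v w i h => Or.inl ⟨i, rfl, h⟩
  have toV := ball_path edge
  set z0 := fmk St (BV.o N) with hz0
  have letter : ∀ {v w i}, GPath St v (FreeGroup.of i) w → FoldEd St (fmk St v) i (fmk St w) :=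
    fun path => det_letter (fold_det St) (fold_path hStl path)
  -- the vertices of the cells
  have cellN : ∀ m ∈ S, ∀ q', (cellf (τf m) (qf m) q').norm ≤ N := fun m hm q' =>
    N2 m hm _ (ZMod.val_lt _).le
  have loop : ∀ x, GPath (EdSt (FoldEd St)) z0 (ψ x) z0 := by
    intro x
    induction x using FreeGroup.induction_on with
    | C1 => rw [map_one]; exact GPath.nil z0
    | of i =>
      have t := toV ⟨ψ (FreeGroup.of i), N1 i⟩
      have t2 : GPath St ⟨ψ (FreeGroup.of i), N1 i⟩ 1 (BV.o N) :=
        GPath.single (Or.inr (Or.inl ⟨rfl, rfl, i, rfl⟩))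
      have := fold_path hStl (t.trans t2)
      simpa using this
    | inv_of i ih => rw [map_inv]; exact ih.symm
    | mul x y hx hy => rw [map_mul]; exact hx.trans hy
  have tauN : ∀ m ∈ S, (τf m).norm ≤ N := fun m hm => by
    have := N2 m hm 0 (by omega)
    simpa [W, cyc] using this
  have jmp : ∀ m (hm : m ∈ S0), GPath St
      ⟨τf m * W (qf m) (2 * k), N2 m (Finset.mem_of_mem_erase hm) _ le_rfl⟩ 1
      ⟨τf m, tauN m (Finset.mem_of_mem_erase hm)⟩ := fun m hm =>
    GPath.single (Or.inr (Or.inr ⟨rfl, m, hm, rfl, rfl⟩))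
  set u : ZMod (2 * k) → FoldV St :=
    fun q' => fmk St ⟨cellf (τf m0) (qf m0) q', cellN m0 hm0 q'⟩ with hu
  set b : FoldV St := fmk St ⟨τf m0 * W (qf m0) (2 * k), N2 m0 hm0 _ le_rfl⟩ with hb
  have cfg : Config ρ φ s (FoldV St) (FoldEd St) z0 ψ S0 u (qf m0) b := by
    refine ⟨fold_det St, ?_, hψ, loop, hS0c, ?_, ?_, ?_, ?_, ?_⟩
    · intro z
      obtain ⟨v, rfl⟩ := fmk_surj z
      exact ⟨v.1, fold_path hStl (toV v)⟩
    · intro m hm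
      have hmS := Finset.mem_of_mem_erase hm
      refine ⟨fun q' => fmk St ⟨cellf (τf m) (qf m) q', cellN m hmS q'⟩, ?_, qf m, τf m, ?_, hf m hmS⟩
      · intro q'
        apply letter
        by_cases hq : q' = qf m - 1
        · have t1 : GPath St ⟨cellf (τf m) (qf m) q', cellN m hmS q'⟩ (FreeGroup.of (lab q'))
            ⟨τf m * W (qf m) (2 * k), N2 m hmS _ le_rfl⟩ := GPath.single (edge _ _ _ (by
              rw [hq]; exact (cellf_last _ _).symm))
          have t2 := t1.trans (jmp m hm)
          rw [mul_one] at t2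
          convert t2 using 2
          rw [hq, sub_add_cancel, cellf_self]
        · exact GPath.single (edge _ _ _ (cellf_succ _ _ _ hq))
      · have := fold_path hStl (toV ⟨cellf (τf m) (qf m) (qf m), cellN m hmS _⟩)
        simp only [cellf_self] at this ⊢
        exact this
    · intro g hg
      have hg' := fold_path_inv hg (BV.o N) (BV.o N) rfl rfl
      set B := Subgroup.closure (Set.range ψ ∪ (S0 : Set (FreeGroup (Fin k)))) with hB
      have stp : ∀ v g w, St v g w → v.1 * g * w.1⁻¹ ∈ B := by
        rintro v g w (⟨i, rfl, h⟩ | ⟨rfl, h, i, h'⟩ | ⟨rfl, m, hm, h, h'⟩)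
        · rw [h, mul_inv_cancel]; exact B.one_mem
        · rw [h, h']
          simp only [mul_one, inv_one]
          exact Subgroup.subset_closure (Or.inl ⟨_, rfl⟩)
        · rw [h, h', mul_one, ← hf m (Finset.mem_of_mem_erase hm)]
          exact Subgroup.subset_closure (Or.inr hm)
      have pth : ∀ {v w g}, GPath St v g w → v.1 * g * w.1⁻¹ ∈ B := by
        intro v w g path
        induction path with
        | nil v => simp
        | fwd st _ ih =>
          convert B.mul_mem (stp _ _ _ st) ih using 1
          group
        | bwd st _ ih =>
          convert B.mul_mem (B.inv_mem (stp _ _ _ st)) ih using 1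
          group
      simpa [BV.o] using pth hg'
    · intro q' hq
      exact letter (GPath.single (edge _ _ _ (cellf_succ _ _ _ hq)))
    · exact letter (GPath.single (edge _ _ _ (cellf_last _ _).symm))
    · intro g
      have mono : ∀ {v g w}, GPath (EdSt (FoldEd St)) v g w →
          GPath (JSt (FoldEd St) (u (qf m0)) b) v g w := fun path =>
        GPath.mono (fun v g w h => GPath.single (Or.inl h)) path
      have hloop : ∀ m ∈ S, GPath (JSt (FoldEd St) (u (qf m0)) b) z0 m z0 := by
        intro m hm
        have t1 := mono (fold_path hStl (toV ⟨τf m * W (qf m) (2 * k), N2 m hm _ le_rfl⟩))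
        have t2 := mono (fold_path hStl (toV ⟨τf m, tauN m hm⟩))
        have t3 : GPath (JSt (FoldEd St) (u (qf m0)) b)
          (fmk St ⟨τf m * W (qf m) (2 * k), N2 m hm _ le_rfl⟩) 1 (fmk St ⟨τf m, tauN m hm⟩) := by
          by_cases h0 : m = m0
          · subst h0
            have : GPath (JSt (FoldEd St) (u (qf m)) b) b (1 : FreeGroup (Fin k))⁻¹ (u (qf m)) :=
              GPath.single_inv (Or.inr ⟨rfl, rfl, rfl⟩)
            rw [inv_one] at this
            convert this using 2
            simp only [cellf_self]
          · exact mono (fold_path hStl (jmp m (Finset.mem_erase.2 ⟨h0, hm⟩)))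
        have t4 := (t1.trans t3).trans t2.symm
        rw [mul_one, ← hf m hm] at t4
        exact t4
      refine Subgroup.closure_induction
        (p := fun g _ => GPath (JSt (FoldEd St) (u (qf m0)) b) z0 g z0) ?_ ?_ ?_ ?_ (hgen g)
      · rintro x (⟨y, rfl⟩ | hx)
        · exact mono (loop y)
        · exact hloop x hx
      · exact GPath.nil _
      · intro x y _ _ hx hy
        exact hx.trans hy
      · intro x _ hx
        exact hx.symm
  exact Config.concl hρ hmain _ cfg rfl

theorem main_all {ρ : FreeGroup (Fin k) →* Q} {φ : FreeGroup (Fin n) →* Q}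
    (hρ : ∀ q : ZMod (2 * k), ρ (W q (2 * k)) = 1) (s : ℕ) : MainP ρ φ s := by
  induction s with
  | zero =>
    intro ψ S hψ hS _ hgen
    have e : S = ∅ := Finset.card_eq_zero.1 (by omega)
    subst e
    refine ⟨ψ, hψ, ?_⟩
    intro g
    have := hgen g
    rw [Finset.coe_empty, Set.union_empty, ← MonoidHom.coe_range, Subgroup.closure_eq] at this
    exact this
  | succ s ih => exact main_step hρ ih

theorem lift_surj {ρ : FreeGroup (Fin k) →* Q} {φ : FreeGroup (Fin n) →* Q}
    (hsurj : Function.Surjective ρ)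
    (hker : ρ.ker = Subgroup.normalClosure {nonorientableRelator k})
    (hφ : Function.Surjective φ) : Concl ρ φ := by
  classical
  have h1 : ρ (nonorientableRelator k) = 1 := by
    rw [← MonoidHom.mem_ker, hker]
    exact Subgroup.subset_normalClosure rfl
  choose r hr using hsurj
  set ψ : FreeGroup (Fin n) →* FreeGroup (Fin k) :=
    FreeGroup.lift fun i => r (φ (FreeGroup.of i)) with hψ
  have hl : ρ.comp ψ = φ := by
    ext i
    simp [hψ, hr]
  set Rl : Set (FreeGroup (Fin k)) := Group.conjugatesOfSet {nonorientableRelator k} with hRl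
  -- a finite set of conjugates suffices
  have fin1 : ∀ g : FreeGroup (Fin k), ∃ T : Finset (FreeGroup (Fin k)), (T : Set _) ⊆ Rl ∧
      g ∈ Subgroup.closure (Set.range ψ ∪ (T : Set (FreeGroup (Fin k)))) := by
    intro g
    obtain ⟨x, hx⟩ := hφ (ρ g)
    have h2 : (ψ x)⁻¹ * g ∈ Subgroup.closure Rl := by
      have : (ψ x)⁻¹ * g ∈ ρ.ker := by
        rw [MonoidHom.mem_ker, map_mul, map_inv, ← hx, ← hl]
        simp
      rw [hker] at this
      exact this
    have h3 : ∀ y ∈ Subgroup.closure Rl, ∃ T : Finset (FreeGroup (Fin k)), (T : Set _) ⊆ Rl ∧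
      y ∈ Subgroup.closure (T : Set (FreeGroup (Fin k))) := by
      intro y hy
      induction hy using Subgroup.closure_induction with
      | mem y hy => exact ⟨{y}, by simpa using hy, Subgroup.subset_closure (by simp)⟩
      | one => exact ⟨∅, by simp, Subgroup.one_mem _⟩
      | mul y z _ _ h h' =>
        obtain ⟨T, a, a'⟩ := h
        obtain ⟨T', c, c'⟩ := h'
        refine ⟨T ∪ T', by simp [a, c], Subgroup.mul_mem _ ?_ ?_⟩
        · exact Subgroup.closure_mono (by simp) a'
        · exact Subgroup.closure_mono (by simp) c'
      | inv y _ h =>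
        obtain ⟨T, a, a'⟩ := h
        exact ⟨T, a, Subgroup.inv_mem _ a'⟩
    obtain ⟨T, a, a'⟩ := h3 _ h2
    refine ⟨T, a, ?_⟩
    have e : g = ψ x * ((ψ x)⁻¹ * g) := by group
    rw [e]
    exact Subgroup.mul_mem _ (Subgroup.subset_closure (Or.inl ⟨x, rfl⟩))
      (Subgroup.closure_mono Set.subset_union_right a')
  choose T hT1 hT2 using fun i : Fin k => fin1 (FreeGroup.of i)
  set S := Finset.univ.biUnion T with hS
  refine main_all (rho_W ρ h1) S.card ψ S hl le_rfl ?_ ?_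
  · intro m hm
    obtain ⟨i, _, hi⟩ := Finset.mem_biUnion.1 hm
    have := hT1 i hi
    rw [hRl, Group.mem_conjugatesOfSet_iff] at this
    obtain ⟨a, ha, hc⟩ := this
    rw [Set.mem_singleton_iff] at ha
    subst ha
    obtain ⟨τ, hτ⟩ := isConj_iff.1 hc
    exact ⟨0, τ, by rw [W_zero_eq]; exact hτ.symm⟩
  · intro g
    induction g using FreeGroup.induction_on with
    | C1 => exact Subgroup.one_mem _
    | of i =>
      refine Subgroup.closure_mono (Set.union_subset_union_right _ ?_) (hT2 i)
      intro y hy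
      exact Finset.mem_biUnion.2 ⟨i, Finset.mem_univ _, hy⟩
    | inv_of i ih => exact Subgroup.inv_mem _ ih
    | mul x y hx hy => exact Subgroup.mul_mem _ hx hy

end initial
end NSG

section nielsen
namespace NSG
open FreeGroup hiding map_mul map_inv map_one

section Words
variable {A : Type} [DecidableEq A]

/-- Length of the longest common initial part. -/
def cpl : List A → List A → ℕ
  | a :: l, b :: m => if a = b then cpl l m + 1 else 0
  | _, _ => 0

theorem cpl_spec (l m : List A) : ∃ p a b, l = p ++ a ∧ m = p ++ b ∧ p.length = cpl l m ∧
    (∀ x ∈ a.head?, ∀ y ∈ b.head?, x ≠ y) := by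
  induction l generalizing m with
  | nil => exact ⟨[], [], m, by simp [cpl]⟩
  | cons x l ih =>
    cases m with
    | nil => exact ⟨[], x :: l, [], by simp [cpl]⟩
    | cons y m =>
      by_cases h : x = y
      · obtain ⟨p, a, b, h1, h2, h3, h4⟩ := ih m
        subst h
        exact ⟨x :: p, a, b, by simp [h1], by simp [h2], by simp [cpl, h3], h4⟩
      · exact ⟨[], x :: l, y :: m, by simp, by simp, by simp [cpl, h], by simpa using h⟩

theorem le_cpl_iff (l m : List A) (n : ℕ) : n ≤ cpl l m ↔
    (l.take n = m.take n ∧ n ≤ l.length ∧ n ≤ m.length) := by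
  induction l generalizing m n with
  | nil =>
    simp only [cpl, Nat.le_zero, List.take_nil, List.length_nil]
    constructor
    · rintro rfl; simp
    · tauto
  | cons x l ih =>
    cases m with
    | nil =>
      simp only [cpl, Nat.le_zero, List.take_nil, List.length_nil]
      constructor
      · rintro rfl; simp
      · tauto
    | cons y m =>
      cases n with
      | zero => simp
      | succ n =>
        simp only [cpl, List.take_succ_cons, List.cons.injEq, List.length_cons]
        split_ifs with h
        · simp [ih, h]
        · simp [h]
end Words

section FG
variable {A : Type} [DecidableEq A]

/-- Common initial length of two elements of the free group. -/
def cp (u v : FreeGroup A) : ℕ := cpl u.toWord v.toWord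

theorem le_cp_iff (u v : FreeGroup A) (n : ℕ) : n ≤ cp u v ↔
    (u.toWord.take n = v.toWord.take n ∧ n ≤ u.norm ∧ n ≤ v.norm) := le_cpl_iff _ _ _

theorem cp_comm (u v : FreeGroup A) : cp u v = cp v u := by
  apply le_antisymm <;> rw [le_cp_iff]
  · have := (le_cp_iff u v _).1 le_rfl; tauto
  · have := (le_cp_iff v u _).1 le_rfl; tauto

theorem cp_self (u : FreeGroup A) : cp u u = u.norm := by
  apply le_antisymm
  · exact ((le_cp_iff u u _).1 le_rfl).2.1
  · rw [le_cp_iff]; simp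

theorem cp_ultra (u v w : FreeGroup A) (n : ℕ) (h1 : n ≤ cp u v) (h2 : n ≤ cp v w) :
    n ≤ cp u w := by
  rw [le_cp_iff] at *
  exact ⟨h1.1.trans h2.1, h1.2.1, h2.2.2⟩

theorem cp_eq_of_lt (u v w : FreeGroup A) (h : cp v w < cp u v) : cp u w = cp v w := by
  apply le_antisymm
  · by_contra! h'
    have := cp_ultra v u w (cp v w + 1) (by rw [cp_comm v u]; omega) (by omega)
    omega
  · exact cp_ultra u v w _ h.le le_rfl

theorem isReduced_invRev {L : List (A × Bool)} (h : IsReduced L) : IsReduced (invRev L) := by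
  rw [isReduced_iff_reduce_eq] at *
  rw [reduce_invRev, h]

theorem norm_mk_of_reduced {L : List (A × Bool)} (h : IsReduced L) : (mk L).norm = L.length := by
  rw [FreeGroup.norm, toWord_mk, h.reduce_eq]

theorem norm_inv_mul_add (u v : FreeGroup A) : (u⁻¹ * v).norm + 2 * cp u v = u.norm + v.norm := by
  obtain ⟨p, a, b, h1, h2, h3, h4⟩ := cpl_spec u.toWord v.toWord
  have e : u⁻¹ * v = mk (invRev a ++ b) := by
    have hu : u = mk p * mk a := by rw [mul_mk, ← h1, mk_toWord]
    have hv : v = mk p * mk b := by rw [mul_mk, ← h2, mk_toWord]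
    rw [hu, hv, ← mul_mk, ← inv_mk]; group
  have ra : IsReduced a := List.IsChain.suffix (isReduced_toWord (x := u)) (by rw [h1]; exact (List.suffix_append p a))
  have rb : IsReduced b := List.IsChain.suffix (isReduced_toWord (x := v)) (by rw [h2]; exact (List.suffix_append p b))
  have red : IsReduced (invRev a ++ b) := by
    unfold FreeGroup.IsReduced
    rw [List.isChain_append]
    refine ⟨isReduced_invRev ra, rb, ?_⟩
    intro x hx y hy h
    have : (x.1, !x.2) ∈ a.head? := by
      simp only [invRev, List.getLast?_reverse, List.head?_map] at hx
      cases ha : a.head? with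
      | none => simp [ha] at hx
      | some z => simp [ha] at hx; subst hx; simp
    have := h4 _ this y hy
    by_contra hne
    apply this
    ext
    · exact h
    · show (!x.2) = y.2
      cases hx2 : x.2 <;> cases hy2 : y.2 <;> simp_all
  have hc : cp u v = p.length := h3.symm
  rw [e, norm_mk_of_reduced red, hc]
  simp only [FreeGroup.norm, h1, h2, List.length_append, invRev_length]
  omega

theorem norm_mul_add (u v : FreeGroup A) : (u * v).norm + 2 * cp u⁻¹ v = u.norm + v.norm := by
  have := norm_inv_mul_add u⁻¹ v
  simpa using this

theorem cp_mul (a b : FreeGroup A) : cp (a * b)⁻¹ b⁻¹ + cp a⁻¹ b = b.norm := by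
  have h1 := norm_mul_add a b
  have h2 := norm_mul_add (a * b) b⁻¹
  simp only [mul_inv_cancel_right, norm_inv_eq] at h2
  omega

theorem cp_inv_self_lt (y : FreeGroup A) (hy : y ≠ 1) : 2 * cp y⁻¹ y < y.norm := by
  have h1 := norm_mul_add y y
  have h2 := reduceCyclically.reduce_flatten_replicate_succ (isReduced_toWord (x := y)) 1
  have h0 := reduceCyclically.reduce_flatten_replicate_succ (isReduced_toWord (x := y)) 0
  have e2 : (y * y).norm = (reduce (List.replicate (1+1) y.toWord).flatten).length := by
    simp [FreeGroup.norm, toWord_mul]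
  have e1 : y.norm = (reduce (List.replicate (0+1) y.toWord).flatten).length := by
    simp [FreeGroup.norm]
  rw [h2] at e2
  rw [h0] at e1
  have e3 : (reduceCyclically y.toWord) ≠ [] := by
    intro h
    have := reduceCyclically.conj_conjugator_reduceCyclically y.toWord
    rw [h] at this
    apply hy
    rw [← mk_toWord (x := y), ← this]
    simp only [List.append_nil]
    rw [← mul_mk, ← inv_mk, mul_inv_cancel]
  have := List.length_pos_iff.2 e3
  simp at e1 e2
  omega

end FG

section Nielsen
variable {k n : ℕ}

/-- A number attached to a letter. -/
def dig (x : Fin k × Bool) : ℕ := 2 * x.1.val + cond x.2 1 0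

theorem dig_inj : Function.Injective (dig (k := k)) := by
  rintro ⟨i, b⟩ ⟨j, c⟩ h
  cases b <;> cases c <;> simp [dig] at h <;> first | omega | (ext <;> simp <;> omega)

theorem dig_lt (x : Fin k × Bool) : dig x < 2 * k + 2 := by
  rcases x with ⟨i, b⟩
  have := i.2
  cases b <;> simp [dig] <;> omega

/-- A number attached to a word. -/
def wnum (l : List (Fin k × Bool)) : ℕ := Nat.ofDigits (2 * k + 2) (l.map dig)

theorem wnum_append (l m : List (Fin k × Bool)) :
    wnum (l ++ m) = wnum l + (2 * k + 2) ^ l.length * wnum m := by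
  simp [wnum, Nat.ofDigits_append]

theorem wnum_inj {l m : List (Fin k × Bool)} (h : l.length = m.length) (e : wnum l = wnum m) :
    l = m := by
  apply List.map_injective_iff.2 dig_inj
  refine Nat.ofDigits_inj_of_len_eq (b := 2 * k + 2) (by omega) (by simpa using h) ?_ ?_ e
  · intro a ha
    obtain ⟨x, -, rfl⟩ := List.mem_map.1 ha
    exact dig_lt x
  · intro a ha
    obtain ⟨x, -, rfl⟩ := List.mem_map.1 ha
    exact dig_lt x

/-- The first half of a word. -/
def half (u : FreeGroup (Fin k)) : List (Fin k × Bool) := u.toWord.take ((u.norm + 1) / 2)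

/-- The secondary complexity. -/
def code (u : FreeGroup (Fin k)) : ℕ := wnum (half u) + wnum (half u⁻¹)

theorem code_inv (u : FreeGroup (Fin k)) : code u⁻¹ = code u := by
  simp [code, add_comm]

theorem code_mul (x y : FreeGroup (Fin k)) (m : ℕ) (hm : cp x⁻¹ y = m) (hy : y.norm = 2 * m)
    (hx : 2 * m ≤ x.norm) :
    code (x * y) + wnum (y.toWord.take m) = code x + wnum (y⁻¹.toWord.take m) := by
  have h1 := norm_mul_add x y
  have h2 := cp_mul x y
  have n1 : (x * y).norm = x.norm := by omega
  obtain ⟨t1, l1, l2⟩ := (le_cp_iff x⁻¹ y m).1 (by omega)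
  obtain ⟨t2, l3, l4⟩ := (le_cp_iff (x * y)⁻¹ y⁻¹ m).1 (by omega)
  set p := y.toWord.take m with hp
  set q := y⁻¹.toWord.take m with hq
  have lp : p.length = m := by
    simp only [hp, List.length_take]; exact min_eq_left (by simpa [FreeGroup.norm] using l2)
  have lq : q.length = m := by
    simp only [hq, List.length_take]; exact min_eq_left (by simpa [FreeGroup.norm] using l4)
  set s := x⁻¹.toWord.drop m with hs
  set s' := (x * y)⁻¹.toWord.drop m with hs'
  set r := y.toWord.drop m with hr
  have ex : x⁻¹.toWord = p ++ s := by rw [← t1, hs, List.take_append_drop]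
  have exy : (x * y)⁻¹.toWord = q ++ s' := by rw [← t2, hs', List.take_append_drop]
  have ey : y.toWord = p ++ r := by rw [hp, hr, List.take_append_drop]
  have lr : r.length = m := by
    have : (p ++ r).length = 2 * m := by rw [← ey]; exact hy
    simp at this; omega
  have eq : q = invRev r := by
    rw [hq, toWord_inv, ey, invRev_append]
    rw [List.take_append_of_le_length (by simp [lr]), List.take_of_length_le (by simp [lr])]
  have ss : s' = s := by
    have e1 : mk s' = mk s := by
      have a1 : x⁻¹ = mk p * mk s := by rw [mul_mk, ← ex, mk_toWord]
      have a2 : y⁻¹ * x⁻¹ = mk q * mk s' := by rw [mul_mk, ← exy, mk_toWord, mul_inv_rev]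
      have a3 : y = mk p * mk r := by rw [mul_mk, ← ey, mk_toWord]
      have a4 : mk q = (mk r)⁻¹ := by rw [eq, inv_mk]
      rw [a1, a3, a4] at a2
      have := mul_left_cancel (a := (mk r)⁻¹) (b := mk s) (c := mk s') (by rw [← a2]; group)
      exact this.symm
    have r1 : FreeGroup.IsReduced s :=
      List.IsChain.suffix (isReduced_toWord (x := x⁻¹)) (by rw [ex]; exact (List.suffix_append _ _))
    have r2 : FreeGroup.IsReduced s' :=
      List.IsChain.suffix (isReduced_toWord (x := (x * y)⁻¹))
        (by rw [exy]; exact (List.suffix_append _ _))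
    have := congrArg toWord e1
    rwa [toWord_mk, toWord_mk, r1.reduce_eq, r2.reduce_eq] at this
  have ls : s.length + m = x.norm := by
    have : (p ++ s).length = x.norm := by rw [← ex]; exact norm_inv_eq (x := x)
    simp at this; omega
  have hx1 : half (x * y) = half x := by
    have e1 : x.toWord = invRev s ++ invRev p := by
      rw [← invRev_append, ← ex, ← toWord_inv, inv_inv]
    have e2 : (x * y).toWord = invRev s ++ invRev q := by
      rw [← invRev_append, ← ss, ← exy, ← toWord_inv, inv_inv]
    rw [half, half, n1, e1, e2, List.take_append_of_le_length, List.take_append_of_le_length] <;>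
      simp <;> omega
  have tk : ∀ l : List (Fin k × Bool), l.length = m →
      (l ++ s).take ((x.norm + 1) / 2) = l ++ s.take ((x.norm + 1) / 2 - m) := by
    intro l hl
    rw [List.take_append, hl, List.take_of_length_le (by omega)]
  have hx2 : half x⁻¹ = p ++ s.take ((x.norm + 1) / 2 - m) := by
    rw [half, ex, norm_inv_eq, tk p lp]
  have hx3 : half (x * y)⁻¹ = q ++ s.take ((x.norm + 1) / 2 - m) := by
    rw [half, exy, norm_inv_eq, n1, ss, tk q lq]
  rw [code, code, hx1, hx2, hx3, wnum_append, wnum_append, lp, lq]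
  omega

/-- Pairs of letters that may be adjacent in a reduced word. -/
def Alw (a b : Fin n × Bool) : Prop := a.1 = b.1 → a.2 = b.2

/-- A letter as an element of the free group. -/
def ltr (a : Fin n × Bool) : FreeGroup (Fin n) := mk [a]

theorem ltr_inv (a : Fin n × Bool) : (ltr a)⁻¹ = ltr (a.1, !a.2) := by
  simp [ltr, inv_mk, invRev]

theorem nielsen_inj (f : FreeGroup (Fin n) →* FreeGroup (Fin k))
    (h0 : ∀ a, f (ltr a) ≠ 1)
    (hmin1 : ∀ a b : Fin n × Bool, a.1 ≠ b.1 → (f (ltr a)).norm ≤ (f (ltr a * ltr b)).norm)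
    (hmin2 : ∀ a b : Fin n × Bool, a.1 ≠ b.1 → (f (ltr a)).norm = (f (ltr a * ltr b)).norm →
      code (f (ltr a)) ≤ code (f (ltr a * ltr b))) : Function.Injective f := by
  have inv' : ∀ a : Fin n × Bool, f (ltr (a.1, !a.2)) = (f (ltr a))⁻¹ := fun a => by
    rw [← ltr_inv, map_inv]
  have alw_eq : ∀ a b : Fin n × Bool, Alw a b → ¬ a.1 ≠ b.1 → a = b := by
    intro a b h h'
    push Not at h'
    exact Prod.ext h' (h h')
  have N1 : ∀ a b, Alw a b → 2 * cp (f (ltr a))⁻¹ (f (ltr b)) ≤ (f (ltr b)).norm := by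
    intro a b hab
    by_cases h : a.1 ≠ b.1
    · have h1 := hmin1 a b h
      have h2 := norm_mul_add (f (ltr a)) (f (ltr b))
      rw [map_mul] at h1
      omega
    · rw [alw_eq a b hab h]
      exact (cp_inv_self_lt _ (h0 _)).le
  have N1' : ∀ a b, Alw a b → 2 * cp (f (ltr a))⁻¹ (f (ltr b)) ≤ (f (ltr a)).norm := by
    intro a b hab
    have := N1 (b.1, !b.2) (a.1, !a.2) (by simp only [Alw] at *; grind)
    rw [inv', inv', inv_inv, norm_inv_eq, cp_comm] at this
    exact this
  have N2 : ∀ a b c, Alw a b → Alw b c →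
      cp (f (ltr a))⁻¹ (f (ltr b)) + cp (f (ltr b))⁻¹ (f (ltr c)) < (f (ltr b)).norm := by
    intro a b c hab hbc
    have i1 := N1 a b hab
    have i2 := N1' b c hbc
    have i1' := N1' a b hab
    have i2' := N1 b c hbc
    by_cases h1 : a.1 ≠ b.1
    swap
    · rw [alw_eq a b hab h1] at *
      have := cp_inv_self_lt _ (h0 b)
      omega
    by_cases h2 : b.1 ≠ c.1
    swap
    · rw [← alw_eq b c hbc h2] at *
      have := cp_inv_self_lt _ (h0 b)
      omega
    by_contra hcon
    set m := cp (f (ltr a))⁻¹ (f (ltr b)) with hm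
    have hm' : cp (f (ltr b))⁻¹ (f (ltr c)) = m := by omega
    have hn : (f (ltr b)).norm = 2 * m := by omega
    have c1 := code_mul (f (ltr a)) (f (ltr b)) m rfl hn i1'
    have c2 := code_mul (f (ltr c))⁻¹ (f (ltr b))⁻¹ m (by rw [inv_inv, cp_comm]; exact hm')
      (by rw [norm_inv_eq]; exact hn) (by rw [norm_inv_eq]; omega)
    have d1 := hmin2 a b h1 (by
      have := norm_mul_add (f (ltr a)) (f (ltr b))
      rw [map_mul]; omega)
    have d2 := hmin2 (c.1, !c.2) (b.1, !b.2) (fun h => h2 h.symm) (by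
      have := norm_mul_add (f (ltr c))⁻¹ (f (ltr b))⁻¹
      rw [inv_inv, norm_inv_eq, norm_inv_eq, cp_comm] at this
      rw [map_mul, inv', inv', norm_inv_eq]; omega)
    rw [map_mul] at d1
    rw [map_mul, inv', inv'] at d2
    rw [inv_inv] at c2
    have e : wnum ((f (ltr b)).toWord.take m) = wnum ((f (ltr b))⁻¹.toWord.take m) := by omega
    have hl : m ≤ (f (ltr b)).norm := by omega
    have e2 := wnum_inj (by
      have h3 : m ≤ (f (ltr b)).toWord.length := hl
      have h4 : m ≤ (f (ltr b))⁻¹.toWord.length := by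
        have : (f (ltr b))⁻¹.toWord.length = (f (ltr b)).norm := norm_inv_eq
        omega
      simp only [List.length_take]; omega) e
    have := cp_inv_self_lt _ (h0 b)
    have h5 : m ≤ cp (f (ltr b))⁻¹ (f (ltr b)) := by
      rw [le_cp_iff, norm_inv_eq]; exact ⟨e2.symm, hl, hl⟩
    omega
  -- chains
  have chain : ∀ (L : List (Fin n × Bool)) (P : FreeGroup (Fin k)) (a : Fin n × Bool),
      FreeGroup.IsReduced (a :: L) →
      0 < cp P⁻¹ (f (ltr a))⁻¹ →
      (∀ c, Alw a c → cp (f (ltr a))⁻¹ (f (ltr c)) < cp P⁻¹ (f (ltr a))⁻¹) →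
      P * f (mk L) ≠ 1 := by
    intro L
    induction L with
    | nil =>
      intro P a _ hpos _ hP
      have hP : P = 1 := by simpa [← FreeGroup.one_eq_mk] using hP
      subst hP
      have := ((le_cp_iff _ _ _).1 (Nat.le_refl (cp (1 : FreeGroup (Fin k))⁻¹ (f (ltr a))⁻¹))).2.1
      rw [inv_one] at this hpos
      rw [FreeGroup.norm_one] at this
      omega
    | cons b L ih =>
      intro P a hred hpos hlt
      have hab : Alw a b := (FreeGroup.isReduced_cons_cons.1 hred).1
      have hred' := (FreeGroup.isReduced_cons_cons.1 hred).2
      have e1 : P * f (mk (b :: L)) = (P * f (ltr b)) * f (mk L) := by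
        rw [mul_assoc, ← map_mul, ltr, mul_mk]; rfl
      rw [e1]
      have e2 := cp_eq_of_lt _ _ _ (hlt b hab)
      have e3 := cp_mul P (f (ltr b))
      apply ih _ b hred'
      · have := N1 a b hab
        have h6 : (f (ltr b)).norm ≠ 0 := fun h => h0 b (norm_eq_zero.1 h)
        omega
      · intro c hc
        have := N2 a b c hab hc
        omega
  rw [injective_iff_map_eq_one]
  intro g hg
  by_contra hg1
  have hne : g.toWord ≠ [] := fun h => hg1 (toWord_eq_nil_iff.1 h)
  obtain ⟨a, L, haL⟩ := List.exists_cons_of_ne_nil hne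
  have hnz : (f (ltr a)).norm ≠ 0 := fun h => h0 a (norm_eq_zero.1 h)
  refine chain L (f (ltr a)) a (haL ▸ isReduced_toWord) ?_ ?_ ?_
  · rw [cp_self, norm_inv_eq]; omega
  · intro c hc
    rw [cp_self, norm_inv_eq]
    have := N1' a c hc
    omega
  · rw [← map_mul, ltr, mul_mk]
    have : mk ([a] ++ L) = g := by
      show mk (a :: L) = g
      rw [← haL, mk_toWord]
    rw [this, hg]

open Classical in
/-- The endomorphism changing one generator. -/
noncomputable def chg (i : Fin n) (u v : FreeGroup (Fin n)) :
    FreeGroup (Fin n) →* FreeGroup (Fin n) :=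
  FreeGroup.lift (Function.update FreeGroup.of i (u * FreeGroup.of i * v))

theorem chg_self (i : Fin n) (u v : FreeGroup (Fin n)) :
    chg i u v (FreeGroup.of i) = u * FreeGroup.of i * v := by simp [chg]

theorem chg_ne {i j : Fin n} (h : j ≠ i) (u v : FreeGroup (Fin n)) :
    chg i u v (FreeGroup.of j) = FreeGroup.of j := by simp [chg, h]

theorem chg_comp (i : Fin n) (u v u' v' : FreeGroup (Fin n)) (hu : chg i u v u' = u⁻¹)
    (hv : chg i u v v' = v⁻¹) : (chg i u v).comp (chg i u' v') = MonoidHom.id _ := by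
  ext j
  by_cases h : j = i
  · subst h
    simp only [MonoidHom.comp_apply, chg_self, map_mul, hu, hv, MonoidHom.id_apply]
    group
  · simp [chg_ne h]

theorem exists_nielsen_move (a b : Fin n × Bool) (h : a.1 ≠ b.1) :
    ∃ α : FreeGroup (Fin n) ≃* FreeGroup (Fin n), α (ltr a) = ltr a * ltr b ∧
      ∀ l, l ≠ a.1 → α (FreeGroup.of l) = FreeGroup.of l := by
  have fixb : ∀ u v (e : Bool), chg a.1 u v (ltr (b.1, e)) = ltr (b.1, e) := by
    intro u v e
    have h1 := chg_ne (Ne.symm h) u v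
    cases e
    · have : ltr (b.1, false) = (FreeGroup.of b.1)⁻¹ := by
        simp [ltr, FreeGroup.of, inv_mk, invRev]
      rw [this, map_inv, h1]
    · exact h1
  have hb : ∀ u v, chg a.1 u v (ltr b) = ltr b := fun u v => fixb u v b.2
  rcases a with ⟨i, e⟩
  cases e
  · refine ⟨(chg i (ltr b)⁻¹ 1).toMulEquiv (chg i (ltr b) 1) ?_ ?_, ?_, ?_⟩
    · apply chg_comp
      · rw [map_inv]; exact congrArg _ (hb _ _)
      · simp
    · apply chg_comp
      · rw [inv_inv]; exact hb _ _
      · simp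
    · have : ltr (i, false) = (FreeGroup.of i)⁻¹ := by
        simp [ltr, FreeGroup.of, inv_mk, invRev]
      simp [this, chg_self]
    · intro l hl
      exact chg_ne hl _ _
  · refine ⟨(chg i 1 (ltr b)).toMulEquiv (chg i 1 (ltr b)⁻¹) ?_ ?_, ?_, ?_⟩
    · apply chg_comp
      · simp
      · rw [inv_inv]; exact hb _ _
    · apply chg_comp
      · simp
      · rw [map_inv]; exact congrArg _ (hb _ _)
    · have : ltr (i, true) = (FreeGroup.of i) := rfl
      simp [this, chg_self]
    · intro l hl
      exact chg_ne hl _ _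

theorem norm_ltr (f : FreeGroup (Fin n) →* FreeGroup (Fin k)) (a : Fin n × Bool) :
    (f (ltr a)).norm = (f (FreeGroup.of a.1)).norm ∧
    code (f (ltr a)) = code (f (FreeGroup.of a.1)) := by
  rcases a with ⟨i, e⟩
  cases e
  · have : ltr (i, false) = (FreeGroup.of i)⁻¹ := by
      simp [ltr, FreeGroup.of, inv_mk, invRev]
    rw [this, map_inv, norm_inv_eq, code_inv]
    exact ⟨rfl, rfl⟩
  · exact ⟨rfl, rfl⟩

theorem nielsen_main (ψ : FreeGroup (Fin n) →* FreeGroup (Fin k)) :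
    (∃ (α : FreeGroup (Fin n) ≃* FreeGroup (Fin n)) (i : Fin n), ψ (α (FreeGroup.of i)) = 1) ∨
      Function.Injective ψ := by
  by_contra! hcon
  obtain ⟨h1, h2⟩ := hcon
  apply h2
  let F : (FreeGroup (Fin n) ≃* FreeGroup (Fin n)) → ℕ ×ₗ ℕ := fun α =>
    toLex (∑ i, (ψ (α (FreeGroup.of i))).norm, ∑ i, code (ψ (α (FreeGroup.of i))))
  let α := Function.argmin F
  let f := ψ.comp α.toMonoidHom
  have key : ∀ a b : Fin n × Bool, a.1 ≠ b.1 →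
      ¬ (toLex ((f (ltr a * ltr b)).norm, code (f (ltr a * ltr b))) : ℕ ×ₗ ℕ) <
      toLex ((f (ltr a)).norm, code (f (ltr a))) := by
    intro a b hab hlt
    obtain ⟨β, hβ, hβ'⟩ := exists_nielsen_move a b hab
    apply Function.not_lt_argmin F (β.trans α)
    have g1 := norm_ltr f a
    have g2 := norm_ltr (f.comp β.toMonoidHom) a
    have e0 : (f.comp β.toMonoidHom) (ltr a) = f (ltr a * ltr b) := by
      show f (β (ltr a)) = _
      rw [hβ]
    rw [e0] at g2
    rw [g1.1, g1.2, g2.1, g2.2] at hlt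
    have s1 : ∑ l ∈ Finset.univ.erase a.1, (f (β (FreeGroup.of l))).norm =
        ∑ l ∈ Finset.univ.erase a.1, (f (FreeGroup.of l)).norm :=
      Finset.sum_congr rfl fun l hl => by rw [hβ' l (Finset.ne_of_mem_erase hl)]
    have s2 : ∑ l ∈ Finset.univ.erase a.1, code (f (β (FreeGroup.of l))) =
        ∑ l ∈ Finset.univ.erase a.1, code (f (FreeGroup.of l)) :=
      Finset.sum_congr rfl fun l hl => by rw [hβ' l (Finset.ne_of_mem_erase hl)]
    have t1 := Finset.add_sum_erase Finset.univ (fun l => (f (β (FreeGroup.of l))).norm)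
      (Finset.mem_univ a.1)
    have t2 := Finset.add_sum_erase Finset.univ (fun l => (f (FreeGroup.of l)).norm)
      (Finset.mem_univ a.1)
    have t3 := Finset.add_sum_erase Finset.univ (fun l => code (f (β (FreeGroup.of l))))
      (Finset.mem_univ a.1)
    have t4 := Finset.add_sum_erase Finset.univ (fun l => code (f (FreeGroup.of l)))
      (Finset.mem_univ a.1)
    show (toLex (∑ i, (f (β (FreeGroup.of i))).norm, ∑ i, code (f (β (FreeGroup.of i)))) : ℕ ×ₗ ℕ) <
      toLex (∑ i, (f (FreeGroup.of i)).norm, ∑ i, code (f (FreeGroup.of i)))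
    rw [Prod.Lex.toLex_lt_toLex] at hlt ⊢
    simp only [MonoidHom.comp_apply] at hlt t1 t2 t3 t4 s1 s2 ⊢
    have : ∀ x, f (β.toMonoidHom x) = f (β x) := fun x => rfl
    simp only [this] at hlt
    omega
  have hinj : Function.Injective f := by
    apply nielsen_inj
    · intro a ha
      apply h1 α a.1
      have := (norm_ltr f a).1
      rw [ha, FreeGroup.norm_one] at this
      exact norm_eq_zero.1 this.symm
    · intro a b hab
      have := key a b hab
      rw [Prod.Lex.toLex_lt_toLex] at this
      simp only at this
      omega
    · intro a b hab
      have := key a b hab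
      rw [Prod.Lex.toLex_lt_toLex] at this
      simp only at this
      omega
  intro x y hxy
  apply α.symm.injective
  apply hinj
  show ψ (α (α.symm x)) = ψ (α (α.symm y))
  simpa using hxy

theorem nielsen_final (ψ : FreeGroup (Fin n) →* FreeGroup (Fin k)) (hψ : Function.Surjective ψ) :
    (∃ (α : FreeGroup (Fin n) ≃* FreeGroup (Fin n)) (i : Fin n), ψ (α (FreeGroup.of i)) = 1) ∨
    (∃ h : n = k, ∃ α : FreeGroup (Fin n) ≃* FreeGroup (Fin n),
        ψ.comp α.toMonoidHom = (FreeGroup.freeGroupCongr (finCongr h)).toMonoidHom) := by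
  rcases nielsen_main ψ with h | h
  · exact Or.inl h
  · right
    let e := MulEquiv.ofBijective ψ ⟨h, hψ⟩
    have hn : n = k := by
      simpa using Fintype.card_congr (Equiv.ofFreeGroupEquiv e)
    refine ⟨hn, (FreeGroup.freeGroupCongr (finCongr hn)).trans e.symm, ?_⟩
    ext x
    show e (e.symm _) = _
    rw [MulEquiv.apply_symm_apply]
    rfl
end Nielsen
end NSG

end nielsen

theorem epi_to_nonorientable_surface_group_reducible_or_standard (k n : ℕ) (hk : 1 ≤ k)
    (φ : FreeGroup (Fin n) →* NonorientableSurfaceGroup k) (hφ : Function.Surjective φ) :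
    (∃ (α : FreeGroup (Fin n) ≃* FreeGroup (Fin n)) (i : Fin n),
        (φ.comp α.toMonoidHom) (FreeGroup.of i) = 1) ∨
    (∃ h : n = k, ∃ α : FreeGroup (Fin n) ≃* FreeGroup (Fin n),
        φ.comp α.toMonoidHom =
          (standardRho k).comp (FreeGroup.freeGroupCongr (finCongr h)).toMonoidHom) := by
  have : NeZero k := ⟨by omega⟩
  have hs : Function.Surjective (standardRho k) := QuotientGroup.mk'_surjective _
  have hker : (standardRho k).ker = Subgroup.normalClosure {nonorientableRelator k} :=
    QuotientGroup.ker_mk' _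
  obtain ⟨ψ, hψ, hsurj⟩ := NSG.lift_surj hs hker hφ
  rcases NSG.nielsen_final ψ hsurj with ⟨α, i, h⟩ | ⟨h, α, hα⟩
  · left
    refine ⟨α, i, ?_⟩
    rw [← hψ]
    exact (congrArg (standardRho k) h).trans (map_one _)
  · right
    refine ⟨h, α, ?_⟩
    rw [← hψ, MonoidHom.comp_assoc, hα]
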